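/- Let T > 0 and χ_{2D,f} ∈ ℝ³. A point q ∈ ℝ³ belongs to the en route reachable tube B(f_{2D},T,χ_{2D,i},χ_{2D,f}) if and only if there exist τ ∈ [0,T] and a Dubins trajectory χ on [0,T] with χ(0) = χ_{2D,i} and χ(T) = χ_{2D,f} such that the restriction of χ to [0,τ] is of class CSC or CCC (with possibly degenerate subintervals), the restriction of χ to [τ,T] is of class CSC or CCC (with possibly degenerate subintervals), and q ∈ χ([0,T]). -/

import Mathlib

open MeasureTheory Metric Set

noncomputable section

/-- Right-hand side of the Dubins car dynamics on state `(x, y, γ)`: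
`ẋ = cos γ, ẏ = sin γ, γ̇ = u`. -/
def dubinsRHS (q : ℝ × ℝ × ℝ) (w : ℝ) : ℝ × ℝ × ℝ :=
  (Real.cos q.2.2, Real.sin q.2.2, w)

/-- A Dubins trajectory on `[a, b]` from `x₀`: an (absolutely continuous, in integral
form) solution of the Dubins car equations for a measurable control with values in
`[-1, 1]`. -/
def IsDubinsTraj (a b : ℝ) (x₀ : ℝ × ℝ × ℝ) (χ : ℝ → ℝ × ℝ × ℝ) (u : ℝ → ℝ) : Prop :=
  Measurable u ∧ (∀ t ∈ Set.Icc a b, u t ∈ Set.Icc (-1 : ℝ) 1) ∧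
  ContinuousOn χ (Set.Icc a b) ∧
  ∀ t ∈ Set.Icc a b, χ t = x₀ + ∫ s in a..t, dubinsRHS (χ s) (u s)

/-- The control on `[a, b]` is of class CSC: bang (`±1`), then straight (`0`), then
bang (`±1`), with possibly degenerate subintervals. -/
def IsCSCControl (a b : ℝ) (u : ℝ → ℝ) : Prop :=
  ∃ t₁ t₂, a ≤ t₁ ∧ t₁ ≤ t₂ ∧ t₂ ≤ b ∧
    ∃ c ∈ ({-1, 1} : Set ℝ), ∃ d ∈ ({-1, 1} : Set ℝ),
      (∀ t ∈ Set.Ioo a t₁, u t = c) ∧ (∀ t ∈ Set.Ioo t₁ t₂, u t = 0) ∧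
      (∀ t ∈ Set.Ioo t₂ b, u t = d)

/-- The control on `[a, b]` is of class CCC: bang `c`, then `-c`, then `c`,
with `c = ±1` and possibly degenerate subintervals. -/
def IsCCCControl (a b : ℝ) (u : ℝ → ℝ) : Prop :=
  ∃ t₁ t₂, a ≤ t₁ ∧ t₁ ≤ t₂ ∧ t₂ ≤ b ∧
    ∃ c ∈ ({-1, 1} : Set ℝ),
      (∀ t ∈ Set.Ioo a t₁, u t = c) ∧ (∀ t ∈ Set.Ioo t₁ t₂, u t = -c) ∧
      (∀ t ∈ Set.Ioo t₂ b, u t = c)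

/-- The Dubins reachable set `G(f_{2D}, t, χ_{2D,i})` from the origin. -/
def DubinsReach (t : ℝ) : Set (ℝ × ℝ × ℝ) :=
  {y | ∃ χ u, IsDubinsTraj 0 t (0, 0, 0) χ u ∧ χ t = y}

/-- The Dubins en route reachable tube `B(f_{2D}, T, χ_{2D,i}, χ_{2D,f})`. -/
def DubinsTube (T : ℝ) (χf : ℝ × ℝ × ℝ) : Set (ℝ × ℝ × ℝ) :=
  {q | ∃ χ u, IsDubinsTraj 0 T (0, 0, 0) χ u ∧ χ T = χf ∧ ∃ t ∈ Set.Icc 0 T, χ t = q}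


abbrev DV := ℝ × ℝ × ℝ

def gm (p q : DV) : DV :=
  (p.1 + (Real.cos p.2.2 * q.1 - Real.sin p.2.2 * q.2.1),
   p.2.1 + (Real.sin p.2.2 * q.1 + Real.cos p.2.2 * q.2.1), p.2.2 + q.2.2)

def gi (p : DV) : DV :=
  (-(Real.cos p.2.2 * p.1 + Real.sin p.2.2 * p.2.1),
   Real.sin p.2.2 * p.1 - Real.cos p.2.2 * p.2.1, -p.2.2)

lemma gm_assoc (p q r : DV) : gm (gm p q) r = gm p (gm q r) := by
  simp only [gm, Prod.mk.injEq, Real.cos_add, Real.sin_add]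
  refine ⟨by ring, by ring, by ring⟩

lemma gm_one (p : DV) : gm p 0 = p := by simp [gm]
lemma one_gm (p : DV) : gm 0 p = p := by simp [gm]

lemma gi_gm (p : DV) : gm (gi p) p = 0 := by
  simp only [gm, gi, Prod.ext_iff, Real.cos_neg, Real.sin_neg]
  refine ⟨?_, ?_, ?_⟩ <;> simp <;> ring

lemma gm_gi (p : DV) : gm p (gi p) = 0 := by
  have h := Real.sin_sq_add_cos_sq p.2.2
  simp only [gm, gi, Prod.ext_iff]
  refine ⟨?_, ?_, ?_⟩
  · simp; linear_combination (-p.1) * h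
  · simp; linear_combination (-p.2.1) * h
  · simp

lemma gi_gm_cancel (p q : DV) : gm (gi p) (gm p q) = q := by
  rw [← gm_assoc, gi_gm, one_gm]
lemma gm_gi_cancel (p q : DV) : gm p (gm (gi p) q) = q := by
  rw [← gm_assoc, gm_gi, one_gm]

def Ev (T : ℝ) (γ : ℝ → ℝ) : DV :=
  (∫ t in (0:ℝ)..T, Real.cos (γ t), ∫ t in (0:ℝ)..T, Real.sin (γ t), γ T)

def sh (a : ℝ) (γ : ℝ → ℝ) : ℝ → ℝ := fun t => γ (a + t) - γ a

def Arc (c l : ℝ) : DV := Ev l (fun t => c * t)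

def Slope (γ : ℝ → ℝ) (a b c : ℝ) : Prop := ∀ t ∈ Icc a b, γ t = γ a + c * (t - a)

lemma Ev_split {γ : ℝ → ℝ} (hγ : Continuous γ) (a T : ℝ) :
    Ev T γ = gm (Ev a γ) (Ev (T - a) (sh a γ)) := by
  have hc : Continuous fun t => Real.cos (γ t) := by fun_prop
  have hs : Continuous fun t => Real.sin (γ t) := by fun_prop
  have hshc : Continuous (sh a γ) := by unfold sh; fun_prop
  have hc' : Continuous fun t => Real.cos (sh a γ t) := by fun_prop
  have hs' : Continuous fun t => Real.sin (sh a γ t) := by fun_prop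
  have key : ∀ t, γ (a + t) = γ a + sh a γ t := by intro t; simp [sh]
  have e1 : ∫ t in a..T, Real.cos (γ t) =
      ∫ t in (0:ℝ)..(T-a), Real.cos (γ (a + t)) := by
    rw [intervalIntegral.integral_comp_add_left (fun t => Real.cos (γ t))]; simp
  have e2 : ∫ t in a..T, Real.sin (γ t) =
      ∫ t in (0:ℝ)..(T-a), Real.sin (γ (a + t)) := by
    rw [intervalIntegral.integral_comp_add_left (fun t => Real.sin (γ t))]; simp
  simp only [key, Real.cos_add, Real.sin_add] at e1 e2
  rw [intervalIntegral.integral_sub ((hc'.const_mul _).intervalIntegrable _ _)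
    ((hs'.const_mul _).intervalIntegrable _ _), intervalIntegral.integral_const_mul,
    intervalIntegral.integral_const_mul] at e1
  rw [intervalIntegral.integral_add ((hc'.const_mul _).intervalIntegrable _ _)
    ((hs'.const_mul _).intervalIntegrable _ _), intervalIntegral.integral_const_mul,
    intervalIntegral.integral_const_mul] at e2
  simp only [Ev, gm, Prod.mk.injEq]
  refine ⟨?_, ?_, ?_⟩
  · rw [← e1, intervalIntegral.integral_add_adjacent_intervals] <;>
      exact hc.intervalIntegrable _ _
  · rw [← e2, intervalIntegral.integral_add_adjacent_intervals] <;>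
      exact hs.intervalIntegrable _ _
  · simp [sh]

lemma Ev_congr {γ δ : ℝ → ℝ} {T : ℝ} (hT : 0 ≤ T) (h : ∀ t ∈ Icc 0 T, γ t = δ t) :
    Ev T γ = Ev T δ := by
  have h' : ∀ t ∈ uIcc 0 T, γ t = δ t := by rwa [uIcc_of_le hT]
  simp only [Ev, Prod.mk.injEq]
  refine ⟨intervalIntegral.integral_congr fun t ht => ?_,
    intervalIntegral.integral_congr fun t ht => ?_, h T ⟨hT, le_rfl⟩⟩ <;> simp [h' t ht]

lemma Slope.arc {γ : ℝ → ℝ} {a b c : ℝ} (hab : a ≤ b) (h : Slope γ a b c) :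
    Ev (b - a) (sh a γ) = Arc c (b - a) := by
  refine Ev_congr (by linarith) fun t ht => ?_
  have := h (a + t) ⟨by linarith [ht.1], by linarith [ht.2]⟩
  simp [sh, this]

lemma Slope.sub {γ : ℝ → ℝ} {a b c a' b' : ℝ} (h : Slope γ a b c) (h1 : a ≤ a') (h2 : a' ≤ b')
    (h3 : b' ≤ b) : Slope γ a' b' c := by
  intro t ht
  rw [h t ⟨by linarith [ht.1], by linarith [ht.2]⟩, h a' ⟨h1, by linarith⟩]; ring

lemma Slope.ev {γ : ℝ → ℝ} (hγ : Continuous γ) {a b c : ℝ} (hab : a ≤ b) (h : Slope γ a b c) :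
    Ev b γ = gm (Ev a γ) (Arc c (b - a)) := by
  rw [Ev_split hγ a b, h.arc hab]

lemma Arc_zero_len (c : ℝ) : Arc c 0 = 0 := by simp [Arc, Ev]
lemma Arc_zero (l : ℝ) : Arc 0 l = (l, 0, 0) := by simp [Arc, Ev]
lemma Arc_one (l : ℝ) : Arc 1 l = (Real.sin l, 1 - Real.cos l, l) := by
  simp [Arc, Ev]
lemma Arc_neg_one (l : ℝ) : Arc (-1) l = (Real.sin l, Real.cos l - 1, -l) := by
  simp [Arc, Ev]

lemma Arc_add (c l l' : ℝ) : Arc c (l + l') = gm (Arc c l) (Arc c l') := by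
  unfold Arc
  rw [Ev_split (by fun_prop) l (l + l')]
  congr 2
  · ring
  · ext t; simp [sh]; ring

lemma Arc_loop (n : ℕ) (c : ℝ) (hc : c = 1 ∨ c = -1) :
    Arc c (2 * Real.pi * n) = (0, 0, c * (2 * Real.pi * n)) := by
  have e1 : Real.cos (2 * Real.pi * n) = 1 := by
    rw [mul_comm]; exact Real.cos_nat_mul_two_pi n
  have e2 : Real.sin (2 * Real.pi * n) = 0 := by
    have := Real.sin_nat_mul_pi (2 * n)
    push_cast at this
    rw [← this]; congr 1; ring
  rcases hc with rfl | rfl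
  · simp [Arc_one, e1, e2]
  · simp [Arc_neg_one, e1, e2]

/-- admissible heading functions -/
def Adm (γ : ℝ → ℝ) : Prop := LipschitzWith 1 γ ∧ γ 0 = 0

lemma Adm.abs {γ : ℝ → ℝ} (h : Adm γ) (s t : ℝ) : |γ s - γ t| ≤ |s - t| := by
  have := h.1.dist_le_mul s t
  simpa [Real.dist_eq] using this

lemma Adm.cont {γ : ℝ → ℝ} (h : Adm γ) : Continuous γ := h.1.continuous

lemma adm_of {γ : ℝ → ℝ} (h : ∀ s t, |γ s - γ t| ≤ |s - t|) (h0 : γ 0 = 0) : Adm γ :=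
  ⟨LipschitzWith.of_dist_le_mul (by simpa [Real.dist_eq] using h), h0⟩

lemma Adm.sh {γ : ℝ → ℝ} (h : Adm γ) (a : ℝ) : Adm (sh a γ) := by
  refine adm_of (fun s t => ?_) (by simp [_root_.sh])
  have := h.abs (a + s) (a + t)
  simpa [_root_.sh] using this

lemma adm_lin {c : ℝ} (hc : |c| ≤ 1) : Adm (fun t => c * t) := by
  refine adm_of (fun s t => ?_) (by simp)
  rw [← mul_sub, abs_mul]
  nlinarith [abs_nonneg (s - t)]

def Reach (T : ℝ) : Set DV := {g | ∃ γ, Adm γ ∧ Ev T γ = g}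

def cat (a : ℝ) (γ δ : ℝ → ℝ) : ℝ → ℝ := fun t => γ (min t a) + δ (max (t - a) 0)

lemma cat_adm {a : ℝ} (ha : 0 ≤ a) {γ δ : ℝ → ℝ} (h1 : Adm γ) (h2 : Adm δ) : Adm (cat a γ δ) := by
  refine adm_of (fun s t => ?_) (by simp [cat, ha, h1.2, h2.2])
  have e1 := h1.abs (min s a) (min t a)
  have e2 := h2.abs (max (s - a) 0) (max (t - a) 0)
  have e3 : |min s a - min t a| + |max (s - a) 0 - max (t - a) 0| ≤ |s - t| := by
    rcases le_total s a with h | h <;> rcases le_total t a with h' | h' <;>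
      simp only [min_eq_left, min_eq_right, max_eq_left, max_eq_right, h, h', sub_nonneg.2,
        sub_nonpos.2, sub_self, abs_zero] <;>
      grind
  unfold cat
  grind

lemma cat_left {a t : ℝ} {γ δ : ℝ → ℝ} (h2 : Adm δ) (h : t ≤ a) : cat a γ δ t = γ t := by
  simp [cat, h, h2.2]

lemma cat_right {a : ℝ} {γ δ : ℝ → ℝ} {t : ℝ} (h : 0 ≤ t) :
    cat a γ δ (a + t) = γ a + δ t := by
  simp [cat, h]

lemma cat_ev {a b : ℝ} (ha : 0 ≤ a) (hb : 0 ≤ b) {γ δ : ℝ → ℝ} (h1 : Adm γ) (h2 : Adm δ) :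
    Ev (a + b) (cat a γ δ) = gm (Ev a γ) (Ev b δ) := by
  rw [Ev_split (cat_adm ha h1 h2).cont a (a + b)]
  congr 1
  · exact Ev_congr ha fun t ht => cat_left h2 ht.2
  · rw [add_sub_cancel_left]
    refine Ev_congr hb fun t ht => ?_
    rw [sh, cat_right ht.1, cat_left h2 le_rfl]; ring

/-- extension of a path by an arc -/
lemma cat_arc {a l c : ℝ} (ha : 0 ≤ a) (hl : 0 ≤ l) (hc : |c| ≤ 1) {γ : ℝ → ℝ} (h1 : Adm γ) :
    ∃ δ, Adm δ ∧ (∀ t ≤ a, δ t = γ t) ∧ Slope δ a (a + l) c ∧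
      Ev (a + l) δ = gm (Ev a γ) (Arc c l) := by
  refine ⟨cat a γ (fun t => c * t), cat_adm ha h1 (adm_lin hc), fun t ht => cat_left (adm_lin hc) ht,
    ?_, cat_ev ha hl h1 (adm_lin hc)⟩
  intro t ht
  have := cat_right (a := a) (γ := γ) (δ := fun t => c * t) (t := t - a) (by linarith [ht.1])
  rw [add_sub_cancel] at this
  rw [this, cat_left (adm_lin hc) le_rfl]

lemma Slope.congr {γ δ : ℝ → ℝ} {a b c : ℝ} (hab : a ≤ b) (h : Slope γ a b c)
    (h' : ∀ t ≤ b, δ t = γ t) : Slope δ a b c := by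
  intro t ht
  rw [h' t ht.2, h' a hab, h t ht]

lemma reach_mul {a b : ℝ} (ha : 0 ≤ a) (hb : 0 ≤ b) {g h : DV} (hg : g ∈ Reach a)
    (hh : h ∈ Reach b) : gm g h ∈ Reach (a + b) := by
  obtain ⟨γ, h1, rfl⟩ := hg
  obtain ⟨δ, h2, rfl⟩ := hh
  exact ⟨_, cat_adm ha h1 h2, cat_ev ha hb h1 h2⟩

lemma reach_arc {c l : ℝ} (hc : |c| ≤ 1) : Arc c l ∈ Reach l := ⟨_, adm_lin hc, rfl⟩

/-- CSC or CCC words -/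
def Wd (T : ℝ) : Set DV := {g | ∃ c₁ c₂ c₃ l₁ l₂ l₃ : ℝ, 0 ≤ l₁ ∧ 0 ≤ l₂ ∧ 0 ≤ l₃ ∧
  l₁ + l₂ + l₃ = T ∧ (c₁ = 1 ∨ c₁ = -1) ∧ (c₃ = 1 ∨ c₃ = -1) ∧
  (c₂ = 0 ∨ (c₂ = -c₁ ∧ c₃ = c₁)) ∧ g = gm (gm (Arc c₁ l₁) (Arc c₂ l₂)) (Arc c₃ l₃)}

/-- robustly reachable -/
def Robust (T : ℝ) (f : DV) : Prop := ∀ᶠ x : ℝ × DV in nhds (T, f), x.2 ∈ Reach x.1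


lemma sep_aux (C : Set DV) (hC : Convex ℝ C) (h0 : (0:DV) ∈ C) (hn : (0:DV) ∉ interior C) :
    ∃ f : DV →ₗ[ℝ] ℝ, f ≠ 0 ∧ ∀ x ∈ C, f x ≤ 0 := by
  by_cases hi : (interior C).Nonempty
  · obtain ⟨f, hf⟩ := geometric_hahn_banach_open_point hC.interior isOpen_interior hn
    refine ⟨f.toLinearMap, ?_, ?_⟩
    · rintro h
      obtain ⟨x, hx⟩ := hi
      have := hf x hx
      have e : f x = 0 := by
        have := congrArg (fun g : DV →ₗ[ℝ] ℝ => g x) h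
        simpa using this
      simp [e] at this
    · intro x hx
      have hx' : x ∈ closure (interior C) := by
        rw [hC.closure_interior_eq_closure_of_nonempty_interior hi]; exact subset_closure hx
      have hcl : IsClosed {y : DV | f y ≤ 0} := isClosed_le f.continuous continuous_const
      have : closure (interior C) ⊆ {y : DV | f y ≤ 0} :=
        closure_minimal (fun y hy => by have := hf y hy; simp at this; exact this.le) hcl
      exact this hx'
  · have hs : affineSpan ℝ C ≠ ⊤ := fun h => hi (hC.interior_nonempty_iff_affineSpan_eq_top.2 h)
    have hs' : Submodule.span ℝ C < ⊤ := by
      rw [lt_top_iff_ne_top]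
      intro h
      apply hs
      rw [AffineSubspace.affineSpan_eq_top_iff_vectorSpan_eq_top_of_nonempty ℝ DV DV ⟨0, h0⟩,
        vectorSpan_eq_span_vsub_set_right ℝ h0]
      simpa using h
    obtain ⟨f, hf, hf'⟩ := Submodule.exists_dual_map_eq_bot_of_lt_top hs' inferInstance
    refine ⟨f, hf, fun x hx => ?_⟩
    have : f x ∈ (Submodule.span ℝ C).map f := ⟨x, Submodule.subset_span hx, rfl⟩
    rw [hf'] at this
    exact le_of_eq (by simpa using this)

/-- first variation -/
def Dv (T : ℝ) (γ h : ℝ → ℝ) : DV :=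
  (∫ t in (0:ℝ)..T, -Real.sin (γ t) * h t, ∫ t in (0:ℝ)..T, Real.cos (γ t) * h t, h T)

lemma Dv_add {T : ℝ} {γ h k : ℝ → ℝ} (hγ : Continuous γ) (hh : Continuous h) (hk : Continuous k) :
    Dv T γ (fun t => h t + k t) = Dv T γ h + Dv T γ k := by
  simp only [Dv, Prod.mk_add_mk, Prod.mk.injEq, mul_add, and_true]
  constructor <;> (rw [intervalIntegral.integral_add] <;>
    (apply Continuous.intervalIntegrable; fun_prop))

lemma Dv_smul {T : ℝ} {γ h : ℝ → ℝ} (c : ℝ) :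
    Dv T γ (fun t => c * h t) = c • Dv T γ h := by
  simp only [Dv, Prod.smul_mk, smul_eq_mul, Prod.mk.injEq, and_true]
  constructor <;> (rw [← intervalIntegral.integral_const_mul]; congr 1; ext t; ring)

def DExt (T : ℝ) (γ : ℝ → ℝ) : Prop := ∃ A B c : ℝ, (A ≠ 0 ∨ B ≠ 0 ∨ c ≠ 0) ∧
  ∀ η, Adm η → A * (Dv T γ (fun t => η t - γ t)).1 + B * (Dv T γ (fun t => η t - γ t)).2.1
    + c * (Dv T γ (fun t => η t - γ t)).2.2 ≤ 0

lemma adm_comb {γ η : ℝ → ℝ} (h1 : Adm γ) (h2 : Adm η) {a b : ℝ} (ha : 0 ≤ a) (hb : 0 ≤ b)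
    (hab : a + b = 1) : Adm (fun t => a * γ t + b * η t) := by
  refine adm_of (fun s t => ?_) (by simp [h1.2, h2.2])
  have e1 := h1.abs s t
  have e2 := h2.abs s t
  calc |a * γ s + b * η s - (a * γ t + b * η t)| = |a * (γ s - γ t) + b * (η s - η t)| := by
        congr 1; ring
    _ ≤ |a * (γ s - γ t)| + |b * (η s - η t)| := abs_add_le _ _
    _ = a * |γ s - γ t| + b * |η s - η t| := by
        rw [abs_mul, abs_mul, abs_of_nonneg ha, abs_of_nonneg hb]
    _ ≤ a * |s - t| + b * |s - t| := by gcongr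
    _ = |s - t| := by rw [← add_mul, hab, one_mul]

lemma ball_of_not_ext {T : ℝ} {γ : ℝ → ℝ} (hγ : Adm γ) (hE : ¬ DExt T γ) :
    ∃ ε > 0, ∀ v : DV, ‖v‖ ≤ ε → ∃ η, Adm η ∧ Dv T γ (fun t => η t - γ t) = v := by
  set C : Set DV := {v | ∃ η, Adm η ∧ Dv T γ (fun t => η t - γ t) = v} with hC
  have hconv : Convex ℝ C := by
    rintro v ⟨η, h1, rfl⟩ w ⟨ζ, h2, rfl⟩ a b ha hb hab
    refine ⟨_, adm_comb h1 h2 ha hb hab, ?_⟩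
    have c0 := hγ.cont
    have c1 := h1.cont
    have c2 := h2.cont
    rw [← Dv_smul, ← Dv_smul, ← Dv_add c0 (by fun_prop) (by fun_prop)]
    congr 1; ext t
    linear_combination (γ t) * hab
  have h0 : (0:DV) ∈ C := ⟨γ, hγ, by simp [Dv]⟩
  have hint : (0:DV) ∈ interior C := by
    by_contra hn
    obtain ⟨f, hf, hf'⟩ := sep_aux C hconv h0 hn
    apply hE
    have key : ∀ v : DV, f v = f (1,0,0) * v.1 + f (0,1,0) * v.2.1 + f (0,0,1) * v.2.2 := by
      intro v
      have : v = v.1 • ((1,0,0):DV) + v.2.1 • ((0,1,0):DV) + v.2.2 • ((0,0,1):DV) := by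
        ext <;> simp
      conv_lhs => rw [this]
      simp only [map_add, map_smul, smul_eq_mul]; ring
    refine ⟨f (1,0,0), f (0,1,0), f (0,0,1), ?_, fun η hη => ?_⟩
    · by_contra! hh
      apply hf
      refine LinearMap.ext fun v => ?_
      rw [key v]; simp [hh]
    · rw [← key]; exact hf' _ ⟨η, hη, rfl⟩
  obtain ⟨ε, hε, hb⟩ := Metric.mem_nhds_iff.1 (mem_interior_iff_mem_nhds.1 hint)
  refine ⟨ε / 2, by positivity, fun v hv => hb ?_⟩
  rw [mem_ball_zero_iff]; linarith

/-- endpoint after time dilation by `κ` -/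
def Ek (T κ : ℝ) (γ : ℝ → ℝ) : DV :=
  (κ * ∫ t in (0:ℝ)..T, Real.cos (κ * γ t), κ * ∫ t in (0:ℝ)..T, Real.sin (κ * γ t), κ * γ T)

lemma Ek_reach {T κ : ℝ} (hκ : 0 < κ) {γ : ℝ → ℝ} (h : Adm γ) : Ek T κ γ ∈ Reach (κ * T) := by
  refine ⟨fun t => κ * γ (t / κ), adm_of (fun s t => ?_) (by simp [h.2]), ?_⟩
  · have := h.abs (s / κ) (t / κ)
    rw [← sub_div, abs_div, abs_of_pos hκ, le_div_iff₀ hκ] at this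
    rw [← mul_sub, abs_mul, abs_of_pos hκ]; linarith
  · simp only [Ev, Ek, Prod.mk.injEq]
    have := hκ.ne'
    refine ⟨?_, ?_, ?_⟩
    · rw [intervalIntegral.integral_comp_div (fun t => Real.cos (κ * γ t)) this]
      simp [this]
    · rw [intervalIntegral.integral_comp_div (fun t => Real.sin (κ * γ t)) this]
      simp [this]
    · field_simp

lemma pt_est {T r κ a b c : ℝ} (hr1 : r ≤ 1) (hκ : |κ - 1| ≤ r) (hc : |c| ≤ T)
    (ha : |a - c| ≤ r) (hb : |b - c| ≤ r) :
    |κ * Real.cos (κ * a) - κ * Real.cos (κ * b) - (-Real.sin c) * (a - b)| ≤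
      (5 + T) * r * |a - b| ∧
    |κ * Real.sin (κ * a) - κ * Real.sin (κ * b) - Real.cos c * (a - b)| ≤
      (5 + T) * r * |a - b| := by
  have hk2 : |κ| ≤ 2 := by
    have := abs_add_le (κ - 1) 1
    simp at this; linarith
  have hr0 : 0 ≤ r := (abs_nonneg _).trans hκ
  have ha' : a ∈ Icc (c - r) (c + r) := by rw [abs_le] at ha; constructor <;> linarith
  have hb' : b ∈ Icc (c - r) (c + r) := by rw [abs_le] at hb; constructor <;> linarith
  have hsq : |κ ^ 2 - 1| ≤ 3 * r := by
    rw [show κ ^ 2 - 1 = (κ + 1) * (κ - 1) by ring, abs_mul]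
    have : |κ + 1| ≤ 3 := by have := abs_add_le κ 1; simp at this; linarith
    nlinarith [abs_nonneg (κ - 1)]
  have hd : ∀ s ∈ Icc (c - r) (c + r), |κ * s - c| ≤ (2 + T) * r := by
    intro s hs
    have h1 : |s - c| ≤ r := by rw [abs_le]; constructor <;> linarith [hs.1, hs.2]
    calc |κ * s - c| = |κ * (s - c) + (κ - 1) * c| := by congr 1; ring
      _ ≤ |κ| * |s - c| + |κ - 1| * |c| := by
        rw [← abs_mul, ← abs_mul]; exact abs_add_le _ _
      _ ≤ 2 * r + r * T := by
        gcongr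
      _ = _ := by ring
  have lipS : ∀ x y : ℝ, |Real.sin x - Real.sin y| ≤ |x - y| := by
    intro x y
    have := Real.lipschitzWith_sin.dist_le_mul x y
    simpa [Real.dist_eq] using this
  have lipC : ∀ x y : ℝ, |Real.cos x - Real.cos y| ≤ |x - y| := by
    intro x y
    have := Real.lipschitzWith_cos.dist_le_mul x y
    simpa [Real.dist_eq] using this
  constructor
  · have := Convex.norm_image_sub_le_of_norm_hasDerivWithin_le (𝕜 := ℝ)
      (f := fun s => κ * Real.cos (κ * s) + Real.sin c * s)
      (f' := fun s => κ * (-Real.sin (κ * s) * κ) + Real.sin c) (s := Icc (c - r) (c + r))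
      (C := (5 + T) * r) (x := b) (y := a)
      (fun s _ => by
        have h1 : HasDerivAt (fun s : ℝ => κ * s) κ s := by
          simpa using (hasDerivAt_id s).const_mul κ
        have h2 : HasDerivAt (fun s : ℝ => Real.sin c * s) (Real.sin c) s := by
          simpa using (hasDerivAt_id s).const_mul (Real.sin c)
        exact ((h1.cos.const_mul κ).add h2).hasDerivWithinAt)
      (fun s hs => by
        rw [Real.norm_eq_abs]
        calc |κ * (-Real.sin (κ * s) * κ) + Real.sin c|
            = |-((κ ^ 2 - 1) * Real.sin (κ * s)) - (Real.sin (κ * s) - Real.sin c)| := by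
              congr 1; ring
          _ ≤ |(κ ^ 2 - 1) * Real.sin (κ * s)| + |Real.sin (κ * s) - Real.sin c| := by
              have := abs_sub (-((κ ^ 2 - 1) * Real.sin (κ * s))) (Real.sin (κ * s) - Real.sin c)
              rwa [abs_neg] at this
          _ ≤ 3 * r * 1 + (2 + T) * r := by
              rw [abs_mul]
              gcongr
              · exact Real.abs_sin_le_one _
              · exact (lipS _ _).trans (hd s hs)
          _ = _ := by ring)
      (convex_Icc _ _) hb' ha'
    rw [Real.norm_eq_abs, Real.norm_eq_abs] at this
    convert this using 2; ring
  · have := Convex.norm_image_sub_le_of_norm_hasDerivWithin_le (𝕜 := ℝ)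
      (f := fun s => κ * Real.sin (κ * s) - Real.cos c * s)
      (f' := fun s => κ * (Real.cos (κ * s) * κ) - Real.cos c) (s := Icc (c - r) (c + r))
      (C := (5 + T) * r) (x := b) (y := a)
      (fun s _ => by
        have h1 : HasDerivAt (fun s : ℝ => κ * s) κ s := by
          simpa using (hasDerivAt_id s).const_mul κ
        have h2 : HasDerivAt (fun s : ℝ => Real.cos c * s) (Real.cos c) s := by
          simpa using (hasDerivAt_id s).const_mul (Real.cos c)
        exact ((h1.sin.const_mul κ).sub h2).hasDerivWithinAt)
      (fun s hs => by
        rw [Real.norm_eq_abs]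
        calc |κ * (Real.cos (κ * s) * κ) - Real.cos c|
            = |((κ ^ 2 - 1) * Real.cos (κ * s)) + (Real.cos (κ * s) - Real.cos c)| := by
              congr 1; ring
          _ ≤ |(κ ^ 2 - 1) * Real.cos (κ * s)| + |Real.cos (κ * s) - Real.cos c| :=
              abs_add_le _ _
          _ ≤ 3 * r * 1 + (2 + T) * r := by
              rw [abs_mul]
              gcongr
              · exact Real.abs_cos_le_one _
              · exact (lipC _ _).trans (hd s hs)
          _ = _ := by ring)
      (convex_Icc _ _) hb' ha'
    rw [Real.norm_eq_abs, Real.norm_eq_abs] at this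
    convert this using 2; ring

lemma Ek_est {T : ℝ} (hT : 0 < T) {γ a b : ℝ → ℝ} (hγ : Adm γ) (hac : Continuous a)
    (hbc : Continuous b) {r κ m : ℝ} (hr1 : r ≤ 1) (hκ : |κ - 1| ≤ r)
    (ha : ∀ t ∈ Icc 0 T, |a t - γ t| ≤ r) (hb : ∀ t ∈ Icc 0 T, |b t - γ t| ≤ r)
    (hm : ∀ t ∈ Icc 0 T, |a t - b t| ≤ m) :
    ‖Ek T κ a - Ek T κ b - Dv T γ (fun t => a t - b t)‖ ≤ (T * (5 + T) + 1) * r * m := by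
  have hγc := hγ.cont
  have hr0 : 0 ≤ r := (abs_nonneg _).trans hκ
  have hm0 : 0 ≤ m := (abs_nonneg _).trans (hm 0 ⟨le_rfl, hT.le⟩)
  have hgb : ∀ t ∈ Icc 0 T, |γ t| ≤ T := by
    intro t ht
    have := hγ.abs t 0
    rw [hγ.2, sub_zero, sub_zero, abs_of_nonneg ht.1] at this
    linarith [ht.2]
  have hp := fun t ht => pt_est hr1 hκ (hgb t ht) (ha t ht) (hb t ht)
  have hK : ∀ F : ℝ → ℝ, (∀ t ∈ Icc 0 T, |F t| ≤ (5 + T) * r * |a t - b t|) →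
      |∫ t in (0:ℝ)..T, F t| ≤ (T * (5 + T) + 1) * r * m := by
    intro F hF
    have := intervalIntegral.norm_integral_le_of_norm_le_const (a := 0) (b := T) (f := F)
      (C := (5 + T) * r * m) (fun t ht => by
        rw [uIoc_of_le hT.le] at ht
        have ht' : t ∈ Icc 0 T := ⟨ht.1.le, ht.2⟩
        refine (hF t ht').trans ?_
        have := hm t ht'
        gcongr)
    rw [Real.norm_eq_abs, sub_zero, abs_of_pos hT] at this
    refine this.trans ?_
    nlinarith [mul_nonneg hr0 hm0]
  rw [Prod.norm_def, Prod.norm_def]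
  simp only [Ek, Dv, Prod.fst_sub, Prod.snd_sub, Real.norm_eq_abs]
  refine max_le ?_ (max_le ?_ ?_)
  · rw [← intervalIntegral.integral_const_mul, ← intervalIntegral.integral_const_mul,
      ← intervalIntegral.integral_sub, ← intervalIntegral.integral_sub]
    · exact hK _ fun t ht => (hp t ht).1
    all_goals (apply Continuous.intervalIntegrable; fun_prop)
  · rw [← intervalIntegral.integral_const_mul, ← intervalIntegral.integral_const_mul,
      ← intervalIntegral.integral_sub, ← intervalIntegral.integral_sub]
    · exact hK _ fun t ht => (hp t ht).2
    all_goals (apply Continuous.intervalIntegrable; fun_prop)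
  · have := hm T ⟨hT.le, le_rfl⟩
    rw [show κ * a T - κ * b T - (a T - b T) = (κ - 1) * (a T - b T) by ring, abs_mul]
    calc |κ - 1| * |a T - b T| ≤ r * m := by gcongr
      _ ≤ _ := by nlinarith [mul_nonneg hr0 hm0, mul_nonneg (mul_nonneg hT.le hT.le) (mul_nonneg hr0 hm0), mul_nonneg hT.le (mul_nonneg hr0 hm0)]

lemma Ek_cont {T : ℝ} {γ : ℝ → ℝ} (hγ : Adm γ) : Continuous fun κ => Ek T κ γ := by
  have := hγ.cont
  unfold Ek
  have h1 : Continuous fun κ : ℝ => ∫ t in (0:ℝ)..T, Real.cos (κ * γ t) :=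
    intervalIntegral.continuous_parametric_intervalIntegral_of_continuous' (by fun_prop) _ _
  have h2 : Continuous fun κ : ℝ => ∫ t in (0:ℝ)..T, Real.sin (κ * γ t) :=
    intervalIntegral.continuous_parametric_intervalIntegral_of_continuous' (by fun_prop) _ _
  fun_prop

lemma Ek_one {T : ℝ} {γ : ℝ → ℝ} : Ek T 1 γ = Ev T γ := by simp [Ek, Ev]


lemma adm_comb6 {γ a b c d e f : ℝ → ℝ} (hγ : Adm γ) (ha : Adm a) (hb : Adm b) (hc : Adm c)
    (hd : Adm d) (he : Adm e) (hf : Adm f) {x y z u v w : ℝ} (hx : 0 ≤ x) (hy : 0 ≤ y)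
    (hz : 0 ≤ z) (hu : 0 ≤ u) (hv : 0 ≤ v) (hw : 0 ≤ w) (hs : x + y + z + u + v + w ≤ 1) :
    Adm (fun t => γ t + x * (a t - γ t) + y * (b t - γ t) + z * (c t - γ t) + u * (d t - γ t)
      + v * (e t - γ t) + w * (f t - γ t)) := by
  apply adm_of
  · intro s t
    have key : ∀ (g : ℝ → ℝ), Adm g → ∀ q : ℝ, 0 ≤ q → q * (g s - g t) ≤ q * |s - t| ∧
        -(q * |s - t|) ≤ q * (g s - g t) := by
      intro g hg q hq
      have := abs_le.1 (hg.abs s t)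
      constructor
      · exact mul_le_mul_of_nonneg_left this.2 hq
      · have := mul_le_mul_of_nonneg_left this.1 hq
        linarith
    have h0 := key γ hγ (1 - (x + y + z + u + v + w)) (by linarith)
    have h1 := key a ha x hx
    have h2 := key b hb y hy
    have h3 := key c hc z hz
    have h4 := key d hd u hu
    have h5 := key e he v hv
    have h6 := key f hf w hw
    rw [abs_le]
    constructor <;> linarith [h0.1, h1.1, h2.1, h3.1, h4.1, h5.1, h6.1,
      h0.2, h1.2, h2.2, h3.2, h4.2, h5.2, h6.2]
  · simp [hγ.2, ha.2, hb.2, hc.2, hd.2, he.2, hf.2]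

lemma DV_norm_le {v : DV} {r : ℝ} : ‖v‖ ≤ r ↔ |v.1| ≤ r ∧ |v.2.1| ≤ r ∧ |v.2.2| ≤ r := by
  simp [Prod.norm_def]

lemma surj_aux (G : DV → DV) {ε τ : ℝ} (hε : 0 < ε) (hτ : 0 < τ)
    (hG : ∀ x ∈ closedBall (0:DV) τ, ∀ y ∈ closedBall (0:DV) τ,
      ‖G x - G y - (2 * ε) • (x - y)‖ ≤ ε * ‖x - y‖) :
    ∀ y, ‖y - G 0‖ ≤ ε * τ → ∃ x ∈ closedBall (0:DV) τ, G x = y := by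
  intro y hy
  let f' : DV →L[ℝ] DV := (2 * ε) • ContinuousLinearMap.id ℝ DV
  have hA : ApproximatesLinearOn G f' (closedBall (0:DV) τ) ⟨ε, hε.le⟩ := by
    intro x hx y hy
    exact hG x hx y hy
  let R : f'.NonlinearRightInverse :=
    { toFun := fun y => (2 * ε)⁻¹ • y
      nnnorm := ⟨(2 * ε)⁻¹, by positivity⟩
      bound' := by
        intro y
        rw [norm_smul, Real.norm_eq_abs, abs_of_pos (by positivity)]; rfl
      right_inv' := by
        intro y
        simp only [f', smul_apply, ContinuousLinearMap.id_apply, smul_smul]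
        rw [mul_inv_cancel₀ (by positivity), one_smul] }
  have := hA.surjOn_closedBall_of_nonlinearRightInverse R hτ.le (b := 0) subset_rfl
  have hy' : y ∈ closedBall (G 0) ((((R.nnnorm : ℝ))⁻¹ - (⟨ε, hε.le⟩ : NNReal)) * τ) := by
    rw [mem_closedBall, dist_eq_norm]
    have e : (((R.nnnorm : ℝ))⁻¹ - ((⟨ε, hε.le⟩ : NNReal):ℝ)) = ε := by
      change ((2 * ε)⁻¹)⁻¹ - ε = ε
      rw [inv_inv]; ring
    rw [e]; exact hy
  exact this hy'

lemma robust_of {T : ℝ} (hT : 0 < T) {γ : ℝ → ℝ} (hγ : Adm γ) (hE : ¬ DExt T γ) :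
    Robust T (Ev T γ) := by
  obtain ⟨ε, hε, hb⟩ := ball_of_not_ext hγ hE
  have nb : ∀ a b c : ℝ, |a| ≤ 1 → |b| ≤ 1 → |c| ≤ 1 → ‖((ε * a, ε * b, ε * c) : DV)‖ ≤ ε := by
    intro a b c ha hb hc
    rw [DV_norm_le]
    simp only [abs_mul, abs_of_pos hε]
    refine ⟨?_, ?_, ?_⟩ <;> nlinarith
  obtain ⟨p1, hp1, ep1⟩ := hb _ (nb 1 0 0 (by simp) (by simp) (by simp))
  obtain ⟨n1, hn1, en1⟩ := hb _ (nb (-1) 0 0 (by simp) (by simp) (by simp))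
  obtain ⟨p2, hp2, ep2⟩ := hb _ (nb 0 1 0 (by simp) (by simp) (by simp))
  obtain ⟨n2, hn2, en2⟩ := hb _ (nb 0 (-1) 0 (by simp) (by simp) (by simp))
  obtain ⟨p3, hp3, ep3⟩ := hb _ (nb 0 0 1 (by simp) (by simp) (by simp))
  obtain ⟨n3, hn3, en3⟩ := hb _ (nb 0 0 (-1) (by simp) (by simp) (by simp))
  have bd : ∀ η, Adm η → ∀ t ∈ Icc 0 T, |η t - γ t| ≤ 2 * T := by
    intro η hη t ht
    have h1 := abs_le.1 (hη.abs t 0)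
    have h2 := abs_le.1 (hγ.abs t 0)
    rw [hη.2, sub_zero, sub_zero, abs_of_nonneg ht.1] at h1
    rw [hγ.2, sub_zero, sub_zero, abs_of_nonneg ht.1] at h2
    rw [abs_le]; constructor <;> linarith [ht.2]
  set K := T * (5 + T) + 1 with hK
  have hKp : 0 < K := by positivity
  obtain ⟨τ, hτ, t1, t2, t3⟩ : ∃ τ : ℝ, 0 < τ ∧ 6 * τ * 2 ≤ 1 ∧ 24 * T * τ ≤ 1 ∧
      K * (24 * T * τ) * (12 * T) ≤ ε / 4 := by
    refine ⟨min (1/12) (min (1 / (24 * T)) (ε / (4 * K * 24 * T * 12 * T))), by positivity, ?_, ?_, ?_⟩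
    · have := min_le_left (1/12:ℝ) (min (1 / (24 * T)) (ε / (4 * K * 24 * T * 12 * T)))
      linarith
    · have := (min_le_right (1/12:ℝ) (min (1 / (24 * T)) (ε / (4 * K * 24 * T * 12 * T)))).trans (min_le_left _ _)
      rw [le_div_iff₀ (by positivity)] at this
      linarith
    · have := (min_le_right (1/12:ℝ) (min (1 / (24 * T)) (ε / (4 * K * 24 * T * 12 * T)))).trans (min_le_right _ _)
      rw [le_div_iff₀ (by positivity)] at this
      linarith
  have c0 := hγ.cont
  have c1 := hp1.cont
  have c2 := hn1.cont
  have c3 := hp2.cont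
  have c4 := hn2.cont
  have c5 := hp3.cont
  have c6 := hn3.cont
  let A : DV → ℝ → ℝ := fun l t => γ t + (τ + l.1) * (p1 t - γ t) + (τ - l.1) * (n1 t - γ t)
    + (τ + l.2.1) * (p2 t - γ t) + (τ - l.2.1) * (n2 t - γ t)
    + (τ + l.2.2) * (p3 t - γ t) + (τ - l.2.2) * (n3 t - γ t)
  have hA : ∀ l ∈ closedBall (0:DV) τ, Adm (A l) := by
    intro l hl
    rw [mem_closedBall_zero_iff, DV_norm_le] at hl
    obtain ⟨h1, h2, h3⟩ := hl
    rw [abs_le] at h1 h2 h3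
    apply adm_comb6 hγ hp1 hn1 hp2 hn2 hp3 hn3 <;> linarith
  have comb : ∀ a b c d e f : ℝ, Dv T γ (fun t => a * (p1 t - γ t) + b * (n1 t - γ t)
      + c * (p2 t - γ t) + d * (n2 t - γ t) + e * (p3 t - γ t) + f * (n3 t - γ t))
      = (ε * (a - b), ε * (c - d), ε * (e - f)) := by
    intro a b c d e f
    rw [Dv_add c0 (by fun_prop) (by fun_prop), Dv_add c0 (by fun_prop) (by fun_prop),
      Dv_add c0 (by fun_prop) (by fun_prop), Dv_add c0 (by fun_prop) (by fun_prop),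
      Dv_add c0 (by fun_prop) (by fun_prop), Dv_smul, Dv_smul, Dv_smul, Dv_smul, Dv_smul, Dv_smul,
      ep1, en1, ep2, en2, ep3, en3]
    simp only [Prod.smul_mk, Prod.mk_add_mk, smul_eq_mul, Prod.mk.injEq]
    refine ⟨by ring, by ring, by ring⟩
  have bcomb : ∀ (a b c d e f m : ℝ), |a| ≤ m → |b| ≤ m → |c| ≤ m → |d| ≤ m → |e| ≤ m → |f| ≤ m →
      ∀ t ∈ Icc 0 T, |a * (p1 t - γ t) + b * (n1 t - γ t)
      + c * (p2 t - γ t) + d * (n2 t - γ t) + e * (p3 t - γ t) + f * (n3 t - γ t)| ≤ 12 * T * m := by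
    intro a b c d e f m ha hb hc hd he hf t ht
    have hm : 0 ≤ m := (abs_nonneg _).trans ha
    have key : ∀ η, Adm η → ∀ q, |q| ≤ m → |q * (η t - γ t)| ≤ m * (2 * T) := by
      intro η hη q hq
      rw [abs_mul]
      exact mul_le_mul hq (bd η hη t ht) (abs_nonneg _) hm
    have h1 := abs_le.1 (key p1 hp1 a ha)
    have h2 := abs_le.1 (key n1 hn1 b hb)
    have h3 := abs_le.1 (key p2 hp2 c hc)
    have h4 := abs_le.1 (key n2 hn2 d hd)
    have h5 := abs_le.1 (key p3 hp3 e he)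
    have h6 := abs_le.1 (key n3 hn3 f hf)
    rw [abs_le]; constructor <;> linarith [h1.1, h1.2, h2.1, h2.2, h3.1, h3.2, h4.1, h4.2, h5.1, h5.2, h6.1, h6.2]
  have hnear : ∀ l ∈ closedBall (0:DV) τ, ∀ t ∈ Icc 0 T, |A l t - γ t| ≤ 24 * T * τ := by
    intro l hl t ht
    rw [mem_closedBall_zero_iff, DV_norm_le] at hl
    obtain ⟨h1, h2, h3⟩ := hl
    rw [abs_le] at h1 h2 h3
    have := bcomb (τ + l.1) (τ - l.1) (τ + l.2.1) (τ - l.2.1) (τ + l.2.2) (τ - l.2.2) (2 * τ)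
      (by rw [abs_le]; constructor <;> linarith) (by rw [abs_le]; constructor <;> linarith)
      (by rw [abs_le]; constructor <;> linarith) (by rw [abs_le]; constructor <;> linarith)
      (by rw [abs_le]; constructor <;> linarith) (by rw [abs_le]; constructor <;> linarith) t ht
    calc _ = _ := by congr 1; simp only [A]; ring
      _ ≤ _ := this
      _ = _ := by ring
  have z0 : (0:DV) ∈ closedBall (0:DV) τ := by simp [hτ.le]
  have hAc : ∀ l, Continuous (A l) := by intro l; fun_prop
  have hsurj : ∀ κ : ℝ, |κ - 1| ≤ 24 * T * τ → ∀ y, ‖y - Ek T κ γ‖ ≤ ε * τ / 2 →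
      ∃ l ∈ closedBall (0:DV) τ, Ek T κ (A l) = y := by
    intro κ hκ y hy
    have s0 : ‖Ek T κ (A 0) - Ek T κ γ‖ ≤ ε * τ / 4 := by
      have := Ek_est hT hγ (hAc 0) c0 t2 hκ (hnear 0 z0) (m := 12 * T * τ)
        (by intro t ht; simp; positivity) (by
          intro t ht
          have := bcomb τ τ τ τ τ τ τ (abs_of_pos hτ).le (abs_of_pos hτ).le (abs_of_pos hτ).le (abs_of_pos hτ).le (abs_of_pos hτ).le (abs_of_pos hτ).le t ht
          calc _ = _ := by congr 1; simp only [A, Prod.fst_zero, Prod.snd_zero]; ring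
            _ ≤ _ := this)
      have e : Dv T γ (fun t => A 0 t - γ t) = 0 := by
        have := comb τ τ τ τ τ τ
        simp only [sub_self, mul_zero] at this
        refine Eq.trans ?_ this
        congr 1; ext t; simp only [A, Prod.fst_zero, Prod.snd_zero]; ring
      rw [e, sub_zero] at this
      refine this.trans ?_
      have := mul_le_mul_of_nonneg_right t3 hτ.le
      rw [← hK]; linarith
    apply surj_aux (fun l => Ek T κ (A l)) hε hτ
    · intro x hx z hz
      have := Ek_est hT hγ (hAc x) (hAc z) t2 hκ (hnear x hx) (hnear z hz) (m := 12 * T * ‖x - z‖)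
        (by
          intro t ht
          have := (DV_norm_le (v := x - z)).1 le_rfl
          obtain ⟨h1, h2, h3⟩ := this
          have := bcomb (x-z).1 (-(x-z).1) (x-z).2.1 (-(x-z).2.1) (x-z).2.2 (-(x-z).2.2) ‖x-z‖
            h1 (by rwa [abs_neg]) h2 (by rwa [abs_neg]) h3 (by rwa [abs_neg]) t ht
          calc _ = _ := by congr 1; simp only [A, Prod.fst_sub, Prod.snd_sub]; ring
            _ ≤ _ := this)
      have e : Dv T γ (fun t => A x t - A z t) = (2 * ε) • (x - z) := by
        have := comb (x-z).1 (-(x-z).1) (x-z).2.1 (-(x-z).2.1) (x-z).2.2 (-(x-z).2.2)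
        trans
        · trans
          swap
          · exact this
          · congr 1; ext t; simp only [A, Prod.fst_sub, Prod.snd_sub]; ring
        · ext <;> simp <;> ring
      rw [e] at this
      refine this.trans ?_
      have := mul_le_mul_of_nonneg_right t3 (norm_nonneg (x - z))
      rw [← hK]; nlinarith [norm_nonneg (x - z)]
    · have : y - Ek T κ (A 0) = (y - Ek T κ γ) - (Ek T κ (A 0) - Ek T κ γ) := by abel
      change ‖y - Ek T κ (A 0)‖ ≤ _
      rw [this]
      refine (norm_sub_le _ _).trans ?_
      have : 0 < ε * τ := by positivity
      linarith
  have hcont : ContinuousAt (fun x : ℝ × DV => x.2 - Ek T (x.1 / T) γ) (T, Ev T γ) := by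
    have := Ek_cont (T := T) hγ
    fun_prop
  have e1 : ∀ᶠ x : ℝ × DV in nhds (T, Ev T γ), ‖x.2 - Ek T (x.1 / T) γ‖ < ε * τ / 2 := by
    have h := hcont.norm
    apply h.eventually_lt continuousAt_const
    simp only [div_self hT.ne', Ek_one, sub_self, norm_zero]; positivity
  have e2 : ∀ᶠ x : ℝ × DV in nhds (T, Ev T γ), |x.1 / T - 1| < 24 * T * τ := by
    have h : ContinuousAt (fun x : ℝ × DV => |x.1 / T - 1|) (T, Ev T γ) := by fun_prop
    apply h.eventually_lt continuousAt_const
    simp only [div_self hT.ne', sub_self, abs_zero]; positivity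
  have e3 : ∀ᶠ x : ℝ × DV in nhds (T, Ev T γ), 0 < x.1 / T := by
    have h : ContinuousAt (fun x : ℝ × DV => x.1 / T) (T, Ev T γ) := by fun_prop
    apply continuousAt_const.eventually_lt h
    simp [div_self hT.ne']
  filter_upwards [e1, e2, e3] with x h1 h2 h3
  obtain ⟨l, hl, e⟩ := hsurj _ h2.le _ h1.le
  have := Ek_reach (T := T) h3 (hA l hl)
  rwa [e, div_mul_cancel₀ _ hT.ne'] at this


lemma spike {T : ℝ} {γ : ℝ → ℝ} (hγ : Adm γ) {A B c : ℝ}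
    (hE : ∀ η, Adm η → A * (Dv T γ (fun t => η t - γ t)).1 + B * (Dv T γ (fun t => η t - γ t)).2.1
    + c * (Dv T γ (fun t => η t - γ t)).2.2 ≤ 0) {σ : ℝ} (hσ : σ = 1 ∨ σ = -1) {a b : ℝ}
    (ha : 0 ≤ a) (hab : a ≤ b) (hb : b ≤ T) :
    (σ * (c + ∫ t in b..T, (-A * Real.sin (γ t) + B * Real.cos (γ t))) - (|A| + |B|) * (b - a)) *
      (b - a - σ * (γ b - γ a)) ≤ 0 := by
  have hs1 : |σ| ≤ 1 := by rcases hσ with rfl | rfl <;> simp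
  have hs2 : σ * σ = 1 := by rcases hσ with rfl | rfl <;> simp
  obtain ⟨δ, hδ, hδ1, hδ2, -⟩ := cat_arc ha (sub_nonneg.2 hab) hs1 hγ
  rw [add_sub_cancel] at hδ2
  set η := cat b δ (sh b γ) with hη
  have hηa : Adm η := cat_adm (ha.trans hab) hδ (hγ.sh b)
  set h : ℝ → ℝ := fun t => η t - γ t with hh
  have hcγ := hγ.cont
  have hch : Continuous h := hηa.cont.sub hcγ
  have h1 : ∀ t ≤ a, h t = 0 := by
    intro t ht
    simp only [hh, hη]
    rw [cat_left (hγ.sh b) (ht.trans hab), hδ1 t ht, sub_self]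
  have h2 : ∀ t ∈ Icc a b, h t = σ * (t - a) - (γ t - γ a) := by
    intro t ht
    simp only [hh, hη]
    rw [cat_left (hγ.sh b) ht.2, hδ2 t ht, hδ1 a le_rfl]; ring
  set d := σ * (b - a) - (γ b - γ a) with hd
  have h3 : ∀ t, b ≤ t → h t = d := by
    intro t ht
    have := cat_right (a := b) (γ := δ) (δ := sh b γ) (t := t - b) (by linarith)
    rw [add_sub_cancel] at this
    simp only [hh, hη]
    rw [this, hδ2 b ⟨hab, le_rfl⟩, hδ1 a le_rfl]
    simp only [sh, hd, add_sub_cancel]; ring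
  set w : ℝ → ℝ := fun t => -A * Real.sin (γ t) + B * Real.cos (γ t) with hw
  have hcw : Continuous w := by fun_prop
  have key := hE η hηa
  have e1 : A * (Dv T γ h).1 + B * (Dv T γ h).2.1 = ∫ t in (0:ℝ)..T, w t * h t := by
    simp only [Dv]
    rw [← intervalIntegral.integral_const_mul, ← intervalIntegral.integral_const_mul,
      ← intervalIntegral.integral_add]
    · congr 1; ext t; simp only [hw]; ring
    all_goals (apply Continuous.intervalIntegrable; fun_prop)
  have ii : ∀ x y, IntervalIntegrable (fun t => w t * h t) volume x y := fun x y =>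
    (hcw.mul hch).intervalIntegrable x y
  have e2 : (∫ t in (0:ℝ)..T, w t * h t) = (∫ t in a..b, w t * h t) + (∫ t in b..T, w t) * d := by
    rw [← intervalIntegral.integral_add_adjacent_intervals (ii 0 a) (ii a T),
      ← intervalIntegral.integral_add_adjacent_intervals (ii a b) (ii b T)]
    have z : (∫ t in (0:ℝ)..a, w t * h t) = 0 := by
      rw [intervalIntegral.integral_congr (g := fun _ => 0)]
      · simp
      · intro t ht
        rw [uIcc_of_le ha] at ht
        simp [h1 t ht.2]
    have z' : (∫ t in b..T, w t * h t) = (∫ t in b..T, w t) * d := by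
      rw [← intervalIntegral.integral_mul_const]
      apply intervalIntegral.integral_congr
      intro t ht
      rw [uIcc_of_le hb] at ht
      simp [h3 t ht.1]
    rw [z, z', zero_add]
  have hσd : b - a - σ * (γ b - γ a) = σ * d := by
    simp only [hd]; linear_combination (-(b - a)) * hs2
  have hLip : ∀ x y, x ≤ y → 0 ≤ y - x - σ * (γ y - γ x) := by
    intro x y hxy
    have := abs_le.1 (hγ.abs y x)
    rw [abs_of_nonneg (by linarith)] at this
    rcases hσ with rfl | rfl <;> linarith
  have hd0 : 0 ≤ σ * d := by rw [← hσd]; exact hLip a b hab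
  have e3 : |∫ t in a..b, w t * h t| ≤ (|A| + |B|) * (σ * d) * (b - a) := by
    have := intervalIntegral.norm_integral_le_of_norm_le_const (a := a) (b := b)
      (f := fun t => w t * h t) (C := (|A| + |B|) * (σ * d)) (by
        intro t ht
        rw [uIoc_of_le hab] at ht
        rw [norm_mul]
        apply mul_le_mul _ _ (norm_nonneg _) (by positivity)
        · simp only [hw, Real.norm_eq_abs]
          refine (abs_add_le _ _).trans ?_
          rw [abs_mul, abs_mul, abs_neg]
          gcongr
          · exact mul_le_of_le_one_right (abs_nonneg _) (Real.abs_sin_le_one _)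
          · exact mul_le_of_le_one_right (abs_nonneg _) (Real.abs_cos_le_one _)
        · rw [h2 t ⟨ht.1.le, ht.2⟩, Real.norm_eq_abs, ← hσd]
          have p1 := hLip a t ht.1.le
          have p2 := hLip t b ht.2
          rw [abs_le]
          rcases hσ with rfl | rfl <;> constructor <;> linarith)
    rwa [Real.norm_eq_abs, abs_of_nonneg (sub_nonneg.2 hab)] at this
  have e4 : (Dv T γ h).2.2 = d := h3 T hb
  have e5 := (abs_le.1 e3).1
  rw [e1, e2, e4] at key
  rw [hσd]
  have : (σ * (c + ∫ t in b..T, w t)) * (σ * d) = (c + ∫ t in b..T, w t) * d := by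
    linear_combination (c + ∫ t in b..T, w t) * d * hs2
  nlinarith

lemma pmp {T : ℝ} {γ : ℝ → ℝ} (hγ : Adm γ) (hE : DExt T γ) :
    ∃ (ρ β : ℝ) (φ : ℝ → ℝ), 0 ≤ ρ ∧ (∀ t, HasDerivAt φ (ρ * Real.sin (γ t - β)) t) ∧
      (ρ = 0 → ∀ t, φ t ≠ 0) ∧
      (∀ σ, (σ = 1 ∨ σ = -1) → ∀ a b, 0 ≤ a → a ≤ b → b ≤ T → (∀ t ∈ Ioo a b, 0 < σ * φ t) →
        Slope γ a b σ) := by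
  obtain ⟨A, B, c, hne, hE⟩ := hE
  have hcγ := hγ.cont
  set w : ℝ → ℝ := fun t => -A * Real.sin (γ t) + B * Real.cos (γ t) with hw
  have hcw : Continuous w := by fun_prop
  set φ : ℝ → ℝ := fun t => c + ∫ s in t..T, w s with hφ
  have hA : A = ‖(⟨A, B⟩ : ℂ)‖ * Real.cos (Complex.arg ⟨A, B⟩) := by
    rw [Complex.norm_mul_cos_arg]
  have hB : B = ‖(⟨A, B⟩ : ℂ)‖ * Real.sin (Complex.arg ⟨A, B⟩) := by
    rw [Complex.norm_mul_sin_arg]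
  set ρ := ‖(⟨A, B⟩ : ℂ)‖ with hρ
  set β := Complex.arg ⟨A, B⟩ with hβ
  have hder : ∀ t, HasDerivAt φ (ρ * Real.sin (γ t - β)) t := by
    intro t
    have h := intervalIntegral.integral_hasDerivAt_left (hcw.intervalIntegrable t T)
      hcw.aestronglyMeasurable.stronglyMeasurableAtFilter hcw.continuousAt
    have h' := h.const_add c
    have e : ρ * Real.sin (γ t - β) = -w t := ?_
    · rw [e]; exact h'
    change ρ * Real.sin (γ t - β) = -(-A * Real.sin (γ t) + B * Real.cos (γ t))
    rw [Real.sin_sub]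
    linear_combination (-Real.sin (γ t)) * hA + Real.cos (γ t) * hB
  have hφc : Continuous φ := continuous_iff_continuousAt.2 fun t => (hder t).continuousAt
  refine ⟨ρ, β, φ, norm_nonneg _, hder, ?_, ?_⟩
  · intro h0 t
    rw [h0, zero_mul] at hA hB
    have hc : c ≠ 0 := by
      rcases hne with h | h | h
      · exact absurd hA h
      · exact absurd hB h
      · exact h
    simp [hφ, hw, hA, hB, hc]
  · intro σ hσ a b ha hab hb hpos
    have hs2 : σ * σ = 1 := by rcases hσ with rfl | rfl <;> simp
    -- local
    have hloc : ∀ x ∈ Ioo a b, HasDerivWithinAt (fun t => t - σ * γ t) 0 (Ici x) x := by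
      intro x hx
      have ev : ∀ᶠ y in nhds x, (|A| + |B|) * (y - x) < σ * φ y := by
        apply ContinuousAt.eventually_lt
        · fun_prop
        · fun_prop
        · simpa using hpos x hx
      have ev2 : ∀ᶠ y in nhds x, y < b := Iio_mem_nhds hx.2
      have : (fun t => t - σ * γ t) =ᶠ[nhdsWithin x (Ici x)] fun _ => x - σ * γ x := by
        filter_upwards [self_mem_nhdsWithin, mem_nhdsWithin_of_mem_nhds ev,
          mem_nhdsWithin_of_mem_nhds ev2] with y h1 h2 h3
        have h4 := spike hγ hE hσ (ha.trans hx.1.le) h1 (h3.le.trans hb)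
        have h5 : 0 ≤ y - x - σ * (γ y - γ x) := by
          have := abs_le.1 (hγ.abs y x)
          have hxy : x ≤ y := h1
          rw [abs_of_nonneg (by linarith)] at this
          rcases hσ with rfl | rfl <;> linarith
        have h6 : 0 < (σ * φ y - (|A| + |B|) * (y - x)) := by linarith
        have h7 : y - x - σ * (γ y - γ x) = 0 :=
          le_antisymm (nonpos_of_mul_nonpos_right h4 h6) h5
        linarith
      exact (hasDerivWithinAt_const _ _ _).congr_of_eventuallyEq this rfl
    have hin : ∀ x ∈ Ioo a b, ∀ y ∈ Icc x b, y - σ * γ y = x - σ * γ x := by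
      intro x hx
      refine constant_of_has_deriv_right_zero (f := fun t => t - σ * γ t) (by fun_prop) ?_
      intro z hz
      exact hloc z ⟨hx.1.trans_le hz.1, hz.2⟩
    intro t ht
    have e : EqOn (fun x => x - σ * γ x) (fun _ => t - σ * γ t) (Icc a t) := by
      rcases ht.1.eq_or_lt with h | h
      · intro x hx
        have : x = t := by rw [← h] at hx ⊢; exact le_antisymm hx.2 hx.1
        simp [this]
      · rw [← closure_Ioo h.ne]
        apply Set.EqOn.closure _ (by fun_prop) (by fun_prop)
        intro x hx
        exact (hin x ⟨hx.1, hx.2.trans_le ht.2⟩ t ⟨hx.2.le, ht.2⟩).symm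
    have := e ⟨le_rfl, ht.1⟩
    simp only at this
    rcases hσ with rfl | rfl <;> linarith


/-- conclusions of the maximum principle -/
structure PM (T : ℝ) (γ : ℝ → ℝ) (ρ β : ℝ) (φ : ℝ → ℝ) : Prop where
  adm : Adm γ
  nn : 0 ≤ ρ
  der : ∀ t, HasDerivAt φ (ρ * Real.sin (γ t - β)) t
  ne : ρ = 0 → ∀ t, φ t ≠ 0
  slope : ∀ σ, (σ = 1 ∨ σ = -1) → ∀ a b, 0 ≤ a → a ≤ b → b ≤ T →
    (∀ t ∈ Ioo a b, 0 < σ * φ t) → Slope γ a b σ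

namespace PM
variable {T : ℝ} {γ : ℝ → ℝ} {ρ β : ℝ} {φ : ℝ → ℝ}

lemma cont (h : PM T γ ρ β φ) : Continuous φ :=
  continuous_iff_continuousAt.2 fun t => (h.der t).continuousAt

lemma slope_inv (h : PM T γ ρ β φ) {σ a b : ℝ} (hσ : σ = 1 ∨ σ = -1) (hab : a ≤ b)
    (hs : Slope γ a b σ) :
    φ b + σ * ρ * Real.cos (γ b - β) = φ a + σ * ρ * Real.cos (γ a - β) := by
  have hc := h.cont
  have hs2 : σ * σ = 1 := by rcases hσ with rfl | rfl <;> simp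
  have := constant_of_has_deriv_right_zero
    (f := fun t => φ t + σ * ρ * Real.cos (γ a + σ * (t - a) - β)) (a := a) (b := b)
    (by fun_prop) (by
      intro x hx
      have h1 := h.der x
      have h2 : HasDerivAt (fun t => γ a + σ * (t - a) - β) (σ * 1) x :=
        ((((hasDerivAt_id x).sub_const a).const_mul σ).const_add (γ a)).sub_const β
      have h3 := (h1.add ((h2.cos).const_mul (σ * ρ))).hasDerivWithinAt (s := Ici x)
      have e : ρ * Real.sin (γ x - β) + σ * ρ * (-Real.sin (γ a + σ * (x - a) - β) * (σ * 1)) = 0 := by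
        rw [← hs x ⟨hx.1, hx.2.le⟩]
        linear_combination (-ρ * Real.sin (γ x - β)) * hs2
      rw [← e]; exact h3) b ⟨hab, le_rfl⟩
  simp only [sub_self, mul_zero, add_zero] at this
  rw [hs b ⟨hab, le_rfl⟩]; exact this

lemma cos_eq (h : PM T γ ρ β φ) {σ a b : ℝ} (hσ : σ = 1 ∨ σ = -1) (hab : a ≤ b)
    (hs : Slope γ a b σ) (ha : φ a = 0) (hb : φ b = 0) :
    Real.cos (γ b - β) = Real.cos (γ a - β) := by
  have h1 := h.slope_inv hσ hab hs
  have hρ : ρ ≠ 0 := fun e => h.ne e a ha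
  rw [ha, hb] at h1
  rcases hσ with rfl | rfl
  · apply mul_left_cancel₀ hρ; linarith
  · apply mul_left_cancel₀ hρ; linarith

/-- sign to the right of a simple zero -/
lemma right_pos {f : ℝ → ℝ} {d x : ℝ} (hf : HasDerivAt f d x) (h0 : f x = 0) (hd : 0 < d) :
    (∃ y > x, ∀ t ∈ Ioo x y, 0 < f t) ∧ (∃ y < x, ∀ t ∈ Ioo y x, f t < 0) := by
  have := eventually_nhdsWithin_sign_eq_of_deriv_pos (f := f) (x₀ := x) (by rw [hf.deriv]; exact hd) h0
  obtain ⟨ε, hε, hh⟩ := Metric.eventually_nhds_iff.1 this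
  constructor
  · refine ⟨x + ε, by linarith, fun t ht => ?_⟩
    have := hh (y := t) (by rw [Real.dist_eq, abs_lt]; constructor <;> linarith [ht.1, ht.2])
    rw [sign_pos (sub_pos.2 ht.1), sign_eq_one_iff] at this
    exact this
  · refine ⟨x - ε, by linarith, fun t ht => ?_⟩
    have := hh (y := t) (by rw [Real.dist_eq, abs_lt]; constructor <;> linarith [ht.1, ht.2])
    rw [sign_neg (sub_neg.2 ht.2), sign_eq_neg_one_iff] at this
    exact this

lemma sgn {x : ℝ} (hx : x ≠ 0) : ∃ σ : ℝ, (σ = 1 ∨ σ = -1) ∧ 0 < σ * x := by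
  rcases hx.lt_or_gt with h | h
  · exact ⟨-1, Or.inr rfl, by linarith⟩
  · exact ⟨1, Or.inl rfl, by linarith⟩

lemma sign_near (h : PM T γ ρ β φ) {x : ℝ} (hx : φ x ≠ 0) :
    ∃ σ : ℝ, (σ = 1 ∨ σ = -1) ∧ ∃ ε > 0, ∀ t ∈ Ioo (x - ε) (x + ε), 0 < σ * φ t := by
  obtain ⟨σ, hσ, hp⟩ := sgn hx
  have hc := h.cont
  have ev : ∀ᶠ t in nhds x, 0 < σ * φ t :=
    continuousAt_const.eventually_lt (by fun_prop) hp
  obtain ⟨ε, hε, hh⟩ := Metric.eventually_nhds_iff.1 ev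
  refine ⟨σ, hσ, ε, hε, fun t ht => hh ?_⟩
  rw [Real.dist_eq, abs_lt]; constructor <;> linarith [ht.1, ht.2]

/-- the sign is constant where `φ` has no zeros -/
lemma sign_ext (h : PM T γ ρ β φ) {σ z y t : ℝ} (hz : 0 < σ * φ z)
    (hn : ∀ t ∈ uIcc z y, φ t ≠ 0) (ht : t ∈ uIcc z y) : 0 < σ * φ t := by
  by_contra! hneg
  have hc := h.cont
  have : (0:ℝ) ∈ uIcc (σ * φ z) (σ * φ t) := ⟨by simp [hneg], by simp [hz.le]⟩
  obtain ⟨w, hw, e⟩ := intermediate_value_uIcc (f := fun t => σ * φ t) (a := z) (b := t) (by fun_prop) this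
  have hσ : σ ≠ 0 := by rintro rfl; simp at hz
  exact hn w (uIcc_subset_uIcc left_mem_uIcc ht hw) ((mul_eq_zero.1 e).resolve_left hσ)

lemma start (h : PM T γ ρ β φ) {x : ℝ} (hx : φ x ≠ 0 ∨ ρ * Real.sin (γ x - β) ≠ 0) :
    ∃ σ : ℝ, (σ = 1 ∨ σ = -1) ∧ ∃ y > x, ∀ t ∈ Ioo x y, 0 < σ * φ t := by
  by_cases h0 : φ x = 0
  · obtain ⟨σ, hσ, hp⟩ := sgn (hx.resolve_left (not_not.2 h0))
    obtain ⟨y, hy, hh⟩ := (right_pos ((h.der x).const_mul σ) (by simp [h0]) hp).1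
    exact ⟨σ, hσ, y, hy, hh⟩
  · obtain ⟨σ, hσ, ε, hε, hh⟩ := h.sign_near h0
    exact ⟨σ, hσ, x + ε, by linarith, fun t ht => hh t ⟨by linarith [ht.1], ht.2⟩⟩

lemma next (h : PM T γ ρ β φ) {x : ℝ} (hx0 : 0 ≤ x) (hxT : x < T)
    (hx : φ x ≠ 0 ∨ ρ * Real.sin (γ x - β) ≠ 0) :
    ∃ σ y : ℝ, (σ = 1 ∨ σ = -1) ∧ x < y ∧ y ≤ T ∧ Slope γ x y σ ∧ (∀ t ∈ Ioo x y, 0 < σ * φ t) ∧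
      (y = T ∨ φ y = 0) ∧ (φ x = 0 → 0 ≤ σ * (ρ * Real.sin (γ x - β))) ∧
      (φ y = 0 → σ * (ρ * Real.sin (γ y - β)) ≤ 0) := by
  obtain ⟨σ, hσ, y0, hy0, hp⟩ := h.start hx
  have hc := h.cont
  obtain ⟨z, hz1, hz2⟩ := exists_between (lt_min hxT hy0)
  have hzT := hz2.trans_le (min_le_left _ _)
  have hzy := hz2.trans_le (min_le_right _ _)
  have hpz := hp z ⟨hz1, hzy⟩
  have main : ∃ y, z ≤ y ∧ y ≤ T ∧ (∀ t ∈ Ico z y, φ t ≠ 0) ∧ (y = T ∨ φ y = 0) := by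
    by_cases hS : ∃ t ∈ Icc z T, φ t = 0
    · have hcl : IsCompact ({t | φ t = 0} ∩ Icc z T) :=
        isCompact_Icc.inter_left (isClosed_eq hc continuous_const)
      obtain ⟨t, ht, h0⟩ := hS
      obtain ⟨y, ⟨hy1, hy2⟩, hy3⟩ := hcl.exists_isLeast ⟨t, h0, ht⟩
      refine ⟨y, hy2.1, hy2.2, fun t ht h0 => ?_, Or.inr hy1⟩
      exact absurd (hy3 ⟨h0, ht.1, ht.2.le.trans hy2.2⟩) (not_le.2 ht.2)
    · push Not at hS
      exact ⟨T, hzT.le, le_rfl, fun t ht => hS t ⟨ht.1, ht.2.le⟩, Or.inl rfl⟩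
  obtain ⟨y, hy1, hy2, hy3, hy4⟩ := main
  have hpos : ∀ t ∈ Ioo x y, 0 < σ * φ t := by
    intro t ht
    rcases lt_or_ge t z with h1 | h1
    · exact hp t ⟨ht.1, h1.trans hzy⟩
    · refine h.sign_ext hpz (y := t) (fun s hs => ?_) right_mem_uIcc
      rw [uIcc_of_le h1] at hs
      exact hy3 s ⟨hs.1, hs.2.trans_lt ht.2⟩
  have hxy : x < y := hz1.trans_le hy1
  refine ⟨σ, y, hσ, hxy, hy2, h.slope σ hσ x y hx0 hxy.le hy2 hpos, hpos, hy4, ?_, ?_⟩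
  · intro h0
    by_contra! hneg
    obtain ⟨w, hw, hh⟩ := (right_pos (((h.der x).const_mul σ).neg) (by simp [h0]) (neg_pos.2 hneg)).1
    obtain ⟨v, hv1, hv2⟩ := exists_between (lt_min hxy hw)
    have a1 := hpos v ⟨hv1, hv2.trans_le (min_le_left _ _)⟩
    have a2 := hh v ⟨hv1, hv2.trans_le (min_le_right _ _)⟩
    simp at a2; linarith
  · intro h0
    by_contra! hneg
    obtain ⟨w, hw, hh⟩ := (right_pos (((h.der y).const_mul σ)) (by simp [h0]) hneg).2
    obtain ⟨v, hv1, hv2⟩ := exists_between (max_lt hxy hw)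
    have a1 := hpos v ⟨(le_max_left _ _).trans_lt hv1, hv2⟩
    have a2 := hh v ⟨(le_max_right _ _).trans_lt hv1, hv2⟩
    linarith

/-- at an interior point where `γ` switches, `φ` vanishes -/
lemma switch (h : PM T γ ρ β φ) {a x b c d : ℝ} (ha : 0 ≤ a) (hax : a < x) (hxb : x < b) (hb : b ≤ T)
    (h1 : Slope γ a x c) (h2 : Slope γ x b d) (hcd : c ≠ d) : φ x = 0 := by
  by_contra h0
  obtain ⟨σ, hσ, ε, hε, hp⟩ := h.sign_near h0
  set l := max a (x - ε) with hl
  set r := min b (x + ε) with hr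
  have l1 : l < x := max_lt hax (by linarith)
  have r1 : x < r := lt_min hxb (by linarith)
  have hs := h.slope σ hσ l r (ha.trans (le_max_left _ _)) (l1.trans r1).le
    ((min_le_left _ _).trans hb) (fun t ht => hp t ⟨(le_max_right _ _).trans_lt ht.1,
      ht.2.trans_le (min_le_right _ _)⟩)
  have e1 := hs x ⟨l1.le, r1.le⟩
  have e2 := hs r ⟨(l1.trans r1).le, le_rfl⟩
  have e3 := h1 l ⟨le_max_left _ _, l1.le⟩
  have e4 := h1 x ⟨hax.le, le_rfl⟩
  have e5 := h2 r ⟨r1.le, min_le_left _ _⟩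
  have : c = σ := by
    apply mul_right_cancel₀ (sub_pos.2 l1).ne'; linarith
  have : d = σ := by
    apply mul_right_cancel₀ (sub_pos.2 r1).ne'; linarith
  exact hcd (by simp [*])

/-- on a singular arc `φ` vanishes -/
lemma sing (h : PM T γ ρ β φ) {a b : ℝ} (ha : 0 ≤ a) (hb : b ≤ T)
    (h1 : Slope γ a b 0) {x : ℝ} (hx : x ∈ Ioo a b) : φ x = 0 := by
  by_contra h0
  obtain ⟨σ, hσ, ε, hε, hp⟩ := h.sign_near h0
  set r := min b (x + ε) with hr
  have r1 : x < r := lt_min hx.2 (by linarith)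
  have hs := h.slope σ hσ x r (ha.trans hx.1.le) r1.le
    ((min_le_left _ _).trans hb) (fun t ht => hp t ⟨by linarith [ht.1],
      ht.2.trans_le (min_le_right _ _)⟩)
  have e1 := hs r ⟨r1.le, le_rfl⟩
  have e2 := h1 x ⟨hx.1.le, hx.2.le⟩
  have e3 := h1 r ⟨(hx.1.trans r1).le, min_le_left _ _⟩
  have : σ * (r - x) = 0 := by linarith
  rcases mul_eq_zero.1 this with e | e
  · rcases hσ with rfl | rfl <;> norm_num at e
  · linarith

lemma ham (h : PM T γ ρ β φ) : ∀ t ∈ Icc 0 T,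
    ρ * Real.cos (γ t - β) + |φ t| = ρ * Real.cos (γ 0 - β) + |φ 0| := by
  have hc := h.cont
  have hγ := h.adm.cont
  refine constant_of_has_deriv_right_zero (f := fun t => ρ * Real.cos (γ t - β) + |φ t|)
    (by fun_prop) ?_
  intro x hx
  by_cases hz : φ x ≠ 0 ∨ ρ * Real.sin (γ x - β) ≠ 0
  · obtain ⟨σ, y, hσ, hxy, hyT, hs, hpos, -⟩ := h.next hx.1 hx.2 hz
    have habs : ∀ t ∈ Ico x y, |φ t| = σ * φ t := by
      have : ∀ t ∈ Ioo x y, |φ t| = σ * φ t := by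
        intro t ht
        have := hpos t ht
        rcases hσ with rfl | rfl
        · rw [abs_of_pos (by linarith)]; ring
        · rw [abs_of_neg (by linarith)]; ring
      have e : EqOn (fun t => |φ t|) (fun t => σ * φ t) (closure (Ioo x y)) :=
        Set.EqOn.closure this (by fun_prop) (by fun_prop)
      rw [closure_Ioo hxy.ne] at e
      intro t ht
      exact e ⟨ht.1, ht.2.le⟩
    have : (fun t => ρ * Real.cos (γ t - β) + |φ t|) =ᶠ[nhdsWithin x (Ici x)]
        fun _ => ρ * Real.cos (γ x - β) + |φ x| := by
      filter_upwards [Ico_mem_nhdsGE hxy] with t ht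
      rw [habs t ht, habs x ⟨le_rfl, hxy⟩]
      have := h.slope_inv hσ ht.1 (hs.sub le_rfl ht.1 ht.2.le)
      rcases hσ with rfl | rfl <;> linarith
    exact (hasDerivWithinAt_const _ _ _).congr_of_eventuallyEq this rfl
  · push Not at hz
    obtain ⟨h0, h1⟩ := hz
    have hρ : ρ ≠ 0 := fun e => h.ne e x h0
    have h2 := (mul_eq_zero.1 h1).resolve_left hρ
    apply HasDerivAt.hasDerivWithinAt
    have d1 : HasDerivAt (fun t => Real.cos (γ t - β)) 0 x := by
      have hd : HasDerivAt (fun u => Real.cos (u - β)) (-Real.sin (γ x - β) * 1) (γ x) :=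
        ((hasDerivAt_id (γ x)).sub_const β).cos
      rw [h2] at hd
      have := hd.isLittleO.comp_tendsto hγ.continuousAt
      rw [hasDerivAt_iff_isLittleO]
      simp only [Function.comp_def, neg_zero, zero_mul, smul_zero, sub_zero] at this ⊢
      refine this.trans_isBigO ?_
      apply Asymptotics.IsBigO.of_bound 1
      filter_upwards with t
      simpa using h.adm.abs t x
    have d2 : HasDerivAt (fun t => |φ t|) 0 x := by
      have := h.der x
      rw [h1] at this
      rw [hasDerivAt_iff_isLittleO] at this ⊢
      simp only [h0, sub_zero, smul_zero, abs_zero] at this ⊢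
      exact this.abs_left
    have d3 := (d1.const_mul ρ).add d2
    rw [mul_zero, add_zero] at d3
    exact d3

end PM


lemma chain3 {γ : ℝ → ℝ} (hγ : Adm γ) {a c₁ l₁ c₂ l₂ c₃ l₃ b : ℝ} (ha : 0 ≤ a) (h1 : 0 ≤ l₁)
    (h2 : 0 ≤ l₂) (h3 : 0 ≤ l₃) (hb : 0 ≤ b) (k1 : |c₁| ≤ 1) (k2 : |c₂| ≤ 1) (k3 : |c₃| ≤ 1)
    {r : DV} (hr : r ∈ Reach b) :
    ∃ δ, Adm δ ∧ (∀ t ≤ a, δ t = γ t) ∧ Slope δ a (a + l₁) c₁ ∧ Slope δ (a + l₁) (a + l₁ + l₂) c₂ ∧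
      Slope δ (a + l₁ + l₂) (a + l₁ + l₂ + l₃) c₃ ∧
      Ev (a + l₁ + l₂ + l₃ + b) δ = gm (gm (gm (gm (Ev a γ) (Arc c₁ l₁)) (Arc c₂ l₂)) (Arc c₃ l₃)) r := by
  obtain ⟨δ1, d1, e1, s1, v1⟩ := cat_arc ha h1 k1 hγ
  obtain ⟨δ2, d2, e2, s2, v2⟩ := cat_arc (add_nonneg ha h1) h2 k2 d1
  obtain ⟨δ3, d3, e3, s3, v3⟩ := cat_arc (add_nonneg (add_nonneg ha h1) h2) h3 k3 d2
  obtain ⟨η, hη, rfl⟩ := hr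
  have e4 : ∀ t ≤ a + l₁ + l₂ + l₃, cat (a + l₁ + l₂ + l₃) δ3 η t = δ3 t := fun t ht => cat_left hη ht
  refine ⟨cat (a + l₁ + l₂ + l₃) δ3 η, cat_adm (by positivity) d3 hη, ?_, ?_, ?_, ?_, ?_⟩
  · intro t ht
    rw [e4 t (by linarith), e3 t (by linarith), e2 t (by linarith), e1 t ht]
  · refine s1.congr (by linarith) fun t ht => ?_
    rw [e4 t (by linarith), e3 t (by linarith), e2 t (by linarith)]
  · refine s2.congr (by linarith) fun t ht => ?_
    rw [e4 t (by linarith), e3 t (by linarith)]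
  · exact s3.congr (by linarith) e4
  · rw [cat_ev (by positivity) hb d3 hη, v3, v2, v1]

lemma arc_swap {s : ℝ} (hs : s = 1 ∨ s = -1) (e b : ℝ) :
    gm (gm (Arc s e) (Arc (-s) b)) (Arc s (b - e)) =
      gm (gm (Arc (-s) (b - e)) (Arc s b)) (Arc (-s) e) := by
  have p1 := Real.sin_sq_add_cos_sq b
  have p2 := Real.sin_sq_add_cos_sq e
  rcases hs with rfl | rfl
  · simp only [Arc_one, Arc_neg_one, gm, Prod.mk.injEq, Real.sin_add, Real.cos_add, Real.sin_neg,
      Real.cos_neg, Real.sin_sub, Real.cos_sub]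
    refine ⟨?_, ?_, by ring⟩ <;> grind
  · simp only [neg_neg, Arc_one, Arc_neg_one, gm, Prod.mk.injEq, Real.sin_add, Real.cos_add, Real.sin_neg,
      Real.cos_neg, Real.sin_sub, Real.cos_sub]
    refine ⟨?_, ?_, by ring⟩ <;> grind

lemma sin_of_cos_eq {x d : ℝ} (hd : 0 < d) (hd2 : d < 2 * Real.pi) {s : ℝ} (hs : s = 1 ∨ s = -1)
    (h : Real.cos (x + s * d) = Real.cos x) : Real.sin (x + s * d / 2) = 0 := by
  have h1 := Real.cos_sub_cos (x + s * d) x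
  rw [h, sub_self] at h1
  have h2 : Real.sin ((x + s * d - x) / 2) ≠ 0 := by
    have := Real.sin_pos_of_pos_of_lt_pi (x := d / 2) (by linarith) (by linarith)
    rcases hs with rfl | rfl
    · rw [show (x + 1 * d - x) / 2 = d / 2 by ring]; exact this.ne'
    · rw [show (x + -1 * d - x) / 2 = -(d / 2) by ring, Real.sin_neg]; linarith
  have h3 : Real.sin ((x + s * d + x) / 2) = 0 := by
    have : Real.sin ((x + s * d + x) / 2) * Real.sin ((x + s * d - x) / 2) = 0 := by linarith
    exact (mul_eq_zero.1 this).resolve_right h2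
  rwa [show (x + s * d + x) / 2 = x + s * d / 2 by ring] at h3

lemma no4 {T : ℝ} {f : DV} (hAll : ∀ δ, Adm δ → Ev T δ = f → ∃ ρ β φ, PM T δ ρ β φ)
    {γ : ℝ → ℝ} (hγ : Adm γ) (hf : Ev T γ = f) {s t1 b : ℝ} (hs : s = 1 ∨ s = -1) (h1 : 0 < t1)
    (hb0 : 0 < b) (hb : b < 2 * Real.pi) (hT : t1 + b + b ≤ T) (s1 : Slope γ 0 t1 s)
    (s2 : Slope γ t1 (t1 + b) (-s)) (s3 : Slope γ (t1 + b) (t1 + b + b) s) : False := by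
  obtain ⟨e, he0, he1, he2⟩ : ∃ e, 0 < e ∧ e < t1 ∧ e < b := by
    obtain ⟨e, h, h'⟩ := exists_between (lt_min h1 hb0)
    exact ⟨e, h, h'.trans_le (min_le_left _ _), h'.trans_le (min_le_right _ _)⟩
  have hs1 : |s| ≤ 1 := by rcases hs with rfl | rfl <;> simp
  have hs1' : |-s| ≤ 1 := by rwa [abs_neg]
  have hns : -s = 1 ∨ -s = -1 := by rcases hs with rfl | rfl <;> simp
  have hne : s ≠ -s := by rcases hs with rfl | rfl <;> norm_num
  have hγc := hγ.cont
  set v := t1 + b + (b - e) with hv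
  have q1 := (s1.sub (a' := t1 - e) (by linarith) (by linarith) le_rfl).ev hγc (by linarith)
  have q2 := s2.ev hγc (by linarith)
  have q3 := (s3.sub (b' := v) le_rfl (by linarith) (by linarith)).ev hγc (by linarith)
  have q4 := Ev_split hγc v T
  obtain ⟨δ, hδ, d0, d1, d2, d3, dE⟩ := chain3 hγ (a := t1 - e) (l₁ := b - e) (l₂ := b) (l₃ := e)
    (b := T - v) (by linarith) (by linarith) hb0.le he0.le (by linarith) hs1' hs1 hs1'
    (r := Ev (T - v) (sh v γ)) ⟨_, hγ.sh v, rfl⟩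
  have hE : Ev T δ = f := by
    rw [show t1 - e + (b - e) + b + e + (T - v) = T by rw [hv]; ring] at dE
    rw [dE, ← hf, q4, q3, q2, q1]
    congr 1
    have := arc_swap hs e b
    rw [show t1 - (t1 - e) = e by ring, show t1 + b - t1 = b by ring, show v - (t1 + b) = b - e by rw [hv]; ring]
    rw [gm_assoc (Ev _ _), gm_assoc (Ev _ _), gm_assoc (Ev _ _), gm_assoc (Ev _ _), this]
  obtain ⟨ρ, β, φ, hP⟩ := hAll δ hδ hE
  have d00 : Slope δ 0 (t1 - e) s := (s1.sub (b' := t1 - e) le_rfl (by linarith) (by linarith)).congr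
    (by linarith) d0
  have z1 : φ (t1 - e) = 0 := hP.switch le_rfl (by linarith) (by linarith) (by linarith) d00 d1 hne
  have z2 := hP.switch (by linarith) (by linarith) (by linarith) (by linarith) d1 d2 hne.symm
  have z3 := hP.switch (by linarith) (by linarith) (by linarith) (by linarith) d2 d3 hne
  have c1 := hP.cos_eq hns (by linarith) d1 z1 z2
  have c2 := hP.cos_eq hs (by linarith) d2 z2 z3
  have e1 := d1 _ ⟨by linarith, le_rfl⟩
  have e2 := d2 _ ⟨by linarith, le_rfl⟩
  set x := δ (t1 - e) - β with hx
  have c3 : Real.cos (x + (-s) * (b - e)) = Real.cos x := by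
    rw [← c1]; congr 1; rw [e1]; ring
  have c4 : Real.cos (x + s * e) = Real.cos x := by
    rw [← c1, ← c2]; congr 1; rw [e2, e1]; ring
  have f1 := sin_of_cos_eq (by linarith) (by linarith) hns c3
  have f2 := sin_of_cos_eq he0 (by linarith) hs c4
  have f3 : Real.sin ((x + s * e / 2) - (x + (-s) * (b - e) / 2)) = 0 := by
    rw [Real.sin_sub, f1, f2]; ring
  have := Real.sin_pos_of_pos_of_lt_pi (x := b / 2) (by linarith) (by linarith)
  rcases hs with rfl | rfl
  · rw [show (x + 1 * e / 2) - (x + (-1) * (b - e) / 2) = b / 2 by ring] at f3; linarith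
  · rw [show (x + -1 * e / 2) - (x + (- -1) * (b - e) / 2) = -(b / 2) by ring, Real.sin_neg] at f3
    linarith

lemma Ev_zero {γ : ℝ → ℝ} (h : Adm γ) : Ev 0 γ = 0 := by simp [Ev, h.2]

lemma case_reg {T : ℝ} (hT : 0 < T) {f : DV}
    (hAll : ∀ δ, Adm δ → Ev T δ = f → ∃ ρ β φ, PM T δ ρ β φ)
    {γ : ℝ → ℝ} (hf : Ev T γ = f) {ρ β : ℝ} {φ : ℝ → ℝ} (h : PM T γ ρ β φ)
    (hz : ∀ x ∈ Icc 0 T, φ x = 0 → ρ * Real.sin (γ x - β) ≠ 0) : f ∈ Wd T := by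
  have hγ := h.adm
  have hγc := hγ.cont
  have hz' : ∀ x ∈ Icc 0 T, φ x ≠ 0 ∨ ρ * Real.sin (γ x - β) ≠ 0 := fun x hx => by
    by_cases e : φ x = 0
    · exact Or.inr (hz x hx e)
    · exact Or.inl e
  obtain ⟨s, t1, hs, h01, h1T, sl1, -, end1, -, sg1⟩ := h.next le_rfl hT (hz' 0 ⟨le_rfl, hT.le⟩)
  have E1 := sl1.ev hγc h01.le
  rw [Ev_zero hγ, one_gm, sub_zero] at E1
  rcases h1T.eq_or_lt with e1 | h1T
  · refine ⟨s, 0, 1, t1, 0, 0, h01.le, le_rfl, le_rfl, by linarith, hs, Or.inl rfl, Or.inl rfl, ?_⟩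
    rw [← hf, ← e1, E1, Arc_zero_len, Arc_zero_len, gm_one, gm_one]
  have z1 := end1.resolve_left h1T.ne
  have sg1 := sg1 z1
  obtain ⟨s2, t2, hs2, h12, h2T, sl2, pos2, end2, sg1', sg2⟩ := h.next h01.le h1T (hz' t1 ⟨h01.le, h1T.le⟩)
  have sg1' := sg1' z1
  have n1 := hz t1 ⟨h01.le, h1T.le⟩ z1
  obtain rfl : s2 = -s := by
    rcases hs with rfl | rfl <;> rcases hs2 with rfl | rfl <;> first | (exfalso; apply n1; linarith) | norm_num
  have E2 := sl2.ev hγc h12.le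
  rcases h2T.eq_or_lt with e1 | h2T
  · refine ⟨s, -s, s, t1, t2 - t1, 0, h01.le, by linarith, le_rfl, by linarith, hs, hs, Or.inr ⟨rfl, rfl⟩, ?_⟩
    rw [← hf, ← e1, E2, E1, Arc_zero_len, gm_one]
  have z2 := end2.resolve_left h2T.ne
  have sg2 := sg2 z2
  obtain ⟨s3, t3, hs3, h23, h3T, sl3, pos3, end3, sg2', sg3⟩ := h.next (by linarith) h2T (hz' t2 ⟨by linarith, h2T.le⟩)
  have sg2' := sg2' z2
  have n2 := hz t2 ⟨by linarith, h2T.le⟩ z2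
  obtain rfl : s3 = s := by
    rcases hs with rfl | rfl <;> rcases hs3 with rfl | rfl <;> first | rfl | (exfalso; apply n2; linarith)
  have E3 := sl3.ev hγc h23.le
  rcases h3T.eq_or_lt with e1 | h3T
  · refine ⟨s3, -s3, s3, t1, t2 - t1, t3 - t2, h01.le, by linarith, by linarith, by linarith, hs, hs,
      Or.inr ⟨rfl, rfl⟩, ?_⟩
    rw [← hf, ← e1, E3, E2, E1]
  exfalso
  have z3 := end3.resolve_left h3T.ne
  have sg3 := sg3 z3
  have n3 := hz t3 ⟨by linarith, h3T.le⟩ z3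
  have hρ : 0 < ρ := h.nn.lt_of_ne' (fun e => h.ne e t1 z1)
  have c12 := h.cos_eq hs2 h12.le sl2 z1 z2
  have c23 := h.cos_eq hs h23.le sl3 z2 z3
  have g2 := sl2 t2 ⟨h12.le, le_rfl⟩
  have g3 := sl3 t3 ⟨h23.le, le_rfl⟩
  -- sines
  have sq1 := Real.sin_sq_add_cos_sq (γ t1 - β)
  have sq2 := Real.sin_sq_add_cos_sq (γ t2 - β)
  have sq3 := Real.sin_sq_add_cos_sq (γ t3 - β)
  have m1 : 0 < -s3 * Real.sin (γ t1 - β) := by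
    have : 0 < ρ * (-s3 * Real.sin (γ t1 - β)) := by
      apply lt_of_le_of_ne (by linarith)
      intro e; apply n1
      rcases hs with rfl | rfl <;> linarith
    exact (mul_pos_iff_of_pos_left hρ).1 this
  have m2 : 0 < s3 * Real.sin (γ t2 - β) := by
    have : 0 < ρ * (s3 * Real.sin (γ t2 - β)) := by
      apply lt_of_le_of_ne (by linarith)
      intro e; apply n2
      rcases hs with rfl | rfl <;> linarith
    exact (mul_pos_iff_of_pos_left hρ).1 this
  have m3 : 0 < -s3 * Real.sin (γ t3 - β) := by
    have : 0 < ρ * (-s3 * Real.sin (γ t3 - β)) := by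
      apply lt_of_le_of_ne (by linarith)
      intro e; apply n3
      rcases hs with rfl | rfl <;> linarith
    exact (mul_pos_iff_of_pos_left hρ).1 this
  have hb : t2 - t1 < 2 * Real.pi := by
    by_contra! hge
    have g := sl2 (t1 + 2 * Real.pi) ⟨by linarith [Real.pi_pos], by linarith⟩
    have sl := sl2.sub (b' := t1 + 2 * Real.pi) le_rfl (by linarith [Real.pi_pos]) (by linarith)
    have inv := h.slope_inv hs2 (by linarith [Real.pi_pos]) sl
    have ang : ∃ k : ℤ, γ (t1 + 2 * Real.pi) - β = γ t1 - β + k * (2 * Real.pi) := by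
      rcases hs with rfl | rfl
      · exact ⟨-1, by rw [g]; push_cast; ring⟩
      · exact ⟨1, by rw [g]; push_cast; ring⟩
    obtain ⟨k, hk⟩ := ang
    rw [hk, Real.cos_add_int_mul_two_pi, z1] at inv
    have z : φ (t1 + 2 * Real.pi) = 0 := by linarith
    rcases hge.eq_or_lt with e | e
    · rw [show t2 = t1 + 2 * Real.pi by linarith, hk, Real.sin_add_int_mul_two_pi] at m2
      linarith
    · have := pos2 (t1 + 2 * Real.pi) ⟨by linarith [Real.pi_pos], by linarith⟩
      rw [z] at this; simp at this
  have s13 : Real.sin (γ t3 - β) = Real.sin (γ t1 - β) := by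
    have : (Real.sin (γ t3 - β) - Real.sin (γ t1 - β)) * (Real.sin (γ t3 - β) + Real.sin (γ t1 - β)) = 0 := by
      rw [c23, c12] at sq3; linarith
    rcases mul_eq_zero.1 this with e | e
    · linarith
    · exfalso
      rcases hs with rfl | rfl <;> linarith
  have hc : Real.cos ((γ t3 - β) - (γ t1 - β)) = 1 := by
    rw [Real.cos_sub, s13, c23, c12]; linarith
  obtain ⟨k, hk⟩ := (Real.cos_eq_one_iff _).1 hc
  have hle : t2 - t1 ≤ t3 - t2 := by
    have hk' : (k:ℝ) * (2 * Real.pi) = s3 * ((t3 - t2) - (t2 - t1)) := by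
      rw [hk, g3, g2]; ring
    by_contra! hlt
    have hpi := Real.pi_pos
    have b1 : |(k:ℝ)| * (2 * Real.pi) < 2 * Real.pi := by
      rw [← abs_of_pos (show 0 < 2 * Real.pi by positivity), ← abs_mul,
        abs_of_pos (show 0 < 2 * Real.pi by positivity), hk', abs_mul]
      rw [show |s3| = 1 by rcases hs with rfl | rfl <;> simp, one_mul, abs_lt]
      constructor <;> linarith
    have b2 : |(k:ℝ)| < 1 := by
      by_contra! hh
      nlinarith
    have b3 : k = 0 := by
      have : |k| < 1 := by exact_mod_cast b2
      exact Int.abs_lt_one_iff.1 this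
    rw [b3] at hk'
    rcases hs with rfl | rfl <;> simp at hk' <;> linarith
  refine no4 hAll hγ hf hs h01 (b := t2 - t1) (by linarith) hb (by linarith) sl1 ?_ ?_
  · rw [add_sub_cancel]; exact sl2
  · rw [add_sub_cancel]; exact sl3.sub le_rfl (by linarith) (by linarith)


lemma lpm (p q : ℕ) (l l' c : ℝ) :
    gm (l, 0, 2 * Real.pi * ((p:ℝ) - q)) (l', 0, c) = (l + l', 0, 2 * Real.pi * ((p:ℝ) - q) + c) := by
  have hc : Real.cos (2 * Real.pi * ((p:ℝ) - q)) = 1 :=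
    (Real.cos_eq_one_iff _).2 ⟨(p:ℤ) - q, by push_cast; ring⟩
  have hs : Real.sin (2 * Real.pi * ((p:ℝ) - q)) = 0 := by
    have := Real.sin_sq_add_cos_sq (2 * Real.pi * ((p:ℝ) - q))
    rw [hc] at this; nlinarith
  simp [gm, hc, hs]

lemma PM.mid {T : ℝ} {γ : ℝ → ℝ} {ρ β : ℝ} {φ : ℝ → ℝ} (h : PM T γ ρ β φ) {m : ℝ} (hm : m ^ 2 = 1)
    (hz : ∀ x ∈ Icc 0 T, φ x = 0 → Real.cos (γ x - β) = m) : ∀ n : ℕ, ∀ s t, 0 ≤ s → s ≤ t → t ≤ T →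
    φ s = 0 → φ t = 0 → t - s < 2 * Real.pi * n → ∃ p q : ℕ, ∃ l : ℝ, 0 ≤ l ∧
      t - s = l + 2 * Real.pi * ((p:ℝ) + q) ∧
      Ev t γ = gm (Ev s γ) (l, 0, 2 * Real.pi * ((p:ℝ) - q)) := by
  have hγ := h.adm
  have hγc := hγ.cont
  have hpi := Real.pi_pos
  have hφc := h.cont
  have per : ∀ x ∈ Icc 0 T, ∀ y ∈ Icc 0 T, φ x = 0 → φ y = 0 → ∃ k : ℤ, γ y - γ x = k * (2 * Real.pi) := by
    intro x hx y hy zx zy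
    have e1 := hz x hx zx
    have e2 := hz y hy zy
    have q1 := Real.sin_sq_add_cos_sq (γ x - β)
    have q2 := Real.sin_sq_add_cos_sq (γ y - β)
    rw [e1, hm] at q1
    rw [e2, hm] at q2
    have s1 : Real.sin (γ x - β) = 0 := by nlinarith
    have : Real.cos (γ y - γ x) = 1 := by
      rw [show γ y - γ x = (γ y - β) - (γ x - β) by ring, Real.cos_sub, e1, e2, s1]
      nlinarith
    obtain ⟨k, hk⟩ := (Real.cos_eq_one_iff _).1 this
    exact ⟨k, hk.symm⟩
  intro n
  induction n with
  | zero => intro s t hs hst ht zs zt hn; simp at hn; linarith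
  | succ n ih =>
    intro s t hs hst ht zs zt hn
    by_cases hall : ∀ x ∈ Icc s t, φ x = 0
    · have hsl : Slope γ s t 0 := by
        have := constant_of_has_deriv_right_zero (f := γ) (a := s) (b := t) (by fun_prop) (by
          intro x hx
          have ev : γ =ᶠ[nhdsWithin x (Ici x)] fun _ => γ x := by
            filter_upwards [Ico_mem_nhdsGE (show x < min t (x + 2 * Real.pi) from
              lt_min hx.2 (by linarith))] with y hy
            have y1 : y < t := hy.2.trans_le (min_le_left _ _)
            have y2 : y < x + 2 * Real.pi := hy.2.trans_le (min_le_right _ _)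
            have hsx := hx.1
            have hxy := hy.1
            obtain ⟨k, hk⟩ := per x ⟨by linarith, by linarith⟩ y ⟨by linarith, by linarith⟩
              (hall x ⟨by linarith, by linarith⟩) (hall y ⟨by linarith, by linarith⟩)
            have b1 := hγ.abs y x
            rw [hk, abs_of_nonneg (show 0 ≤ y - x by linarith), abs_mul, abs_of_pos (show 0 < 2 * Real.pi by positivity)] at b1
            have b2 : |(k:ℝ)| < 1 := by
              by_contra! hh
              nlinarith
            have b3 : k = 0 := Int.abs_lt_one_iff.1 (by exact_mod_cast b2)
            rw [b3] at hk
            simp at hk; linarith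
          exact (hasDerivWithinAt_const _ _ _).congr_of_eventuallyEq ev rfl)
        intro x hx
        rw [this x hx]; ring
      refine ⟨0, 0, t - s, by linarith, by simp, ?_⟩
      rw [hsl.ev hγc hst, Arc_zero]; simp
    · push Not at hall
      obtain ⟨z, hzz, hne⟩ := hall
      have hcl : IsClosed {t | φ t = 0} := isClosed_eq hφc continuous_const
      obtain ⟨a, ⟨za, ha⟩, ha'⟩ := (isCompact_Icc (a := s) (b := z)).inter_left hcl |>.exists_isGreatest
        ⟨s, zs, le_rfl, hzz.1⟩
      obtain ⟨b, ⟨zb, hb⟩, hb'⟩ := (isCompact_Icc (a := z) (b := t)).inter_left hcl |>.exists_isLeast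
        ⟨t, zt, hzz.2, le_rfl⟩
      simp only [mem_ofPred_eq] at za zb
      obtain ⟨σ, hσ, hp⟩ := PM.sgn hne
      have haz : a < z := ha.2.lt_of_ne (by rintro rfl; exact hne za)
      have hzb : z < b := hb.1.lt_of_ne (by rintro rfl; exact hne zb)
      obtain ⟨ha1, ha2⟩ := ha
      obtain ⟨hb1, hb2⟩ := hb
      have hpos : ∀ x ∈ Ioo a b, 0 < σ * φ x := by
        intro x hx
        refine h.sign_ext hp (y := x) (fun w hw hw0 => ?_) right_mem_uIcc
        rcases le_total z x with hzx | hzx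
        · rw [uIcc_of_le hzx] at hw
          have := hb' ⟨hw0, hw.1, hw.2.trans (hx.2.le.trans hb2)⟩
          linarith [hw.2, hx.2]
        · rw [uIcc_of_ge hzx] at hw
          have := ha' ⟨hw0, ha1.trans (hx.1.le.trans hw.1), hw.2⟩
          linarith [hw.1, hx.1]
      have hsl := h.slope σ hσ a b (by linarith) (by linarith) (by linarith) hpos
      obtain ⟨k, hk⟩ := per a ⟨by linarith, by linarith⟩ b ⟨by linarith, by linarith⟩ za zb
      have hab := hsl b ⟨by linarith, le_rfl⟩
      have hN : b - a = 2 * Real.pi * (k.natAbs : ℝ) := by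
        have e : |γ b - γ a| = b - a := by
          rw [hab, add_sub_cancel_left, abs_mul, abs_of_pos (show 0 < b - a by linarith)]
          rcases hσ with rfl | rfl <;> simp
        rw [hk, abs_mul, abs_of_pos (show 0 < 2 * Real.pi by positivity)] at e
        rw [← e, Nat.cast_natAbs, Int.cast_abs]; ring
      set N := k.natAbs with hNdef
      have hN1 : (1:ℝ) ≤ N := by
        have : N ≠ 0 := by
          intro e; rw [e] at hN; simp at hN; linarith
        exact_mod_cast Nat.one_le_iff_ne_zero.2 this
      push_cast at hn
      obtain ⟨p1, q1, l1, hl1, d1, e1⟩ := ih s a hs ha1 (by linarith) zs za (by nlinarith)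
      obtain ⟨p2, q2, l2, hl2, d2, e2⟩ := ih b t (by linarith) hb2 ht zb zt (by nlinarith)
      have e3 := hsl.ev hγc (by linarith)
      rw [hN, Arc_loop _ _ hσ] at e3
      rcases hσ with rfl | rfl
      · refine ⟨p1 + p2 + N, q1 + q2, l1 + l2, by linarith, by push_cast; linarith, ?_⟩
        rw [e2, e3, e1, gm_assoc, gm_assoc]
        congr 1
        have a1 := lpm N 0 0 l2 (2 * Real.pi * ((p2:ℝ) - q2))
        rw [show (1:ℝ) * (2 * Real.pi * N) = 2 * Real.pi * ((N:ℝ) - (0:ℕ)) by push_cast; ring, a1, lpm]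
        simp only [Prod.mk.injEq]; refine ⟨by ring, trivial, by push_cast; ring⟩
      · refine ⟨p1 + p2, q1 + q2 + N, l1 + l2, by linarith, by push_cast; linarith, ?_⟩
        rw [e2, e3, e1, gm_assoc, gm_assoc]
        congr 1
        have a1 := lpm 0 N 0 l2 (2 * Real.pi * ((p2:ℝ) - q2))
        rw [show (-1:ℝ) * (2 * Real.pi * N) = 2 * Real.pi * (((0:ℕ):ℝ) - N) by push_cast; ring, a1, lpm]
        simp only [Prod.mk.injEq]; refine ⟨by ring, trivial, by push_cast; ring⟩

/-- loops commute with everything -/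
lemma loop_comm (n : ℕ) {c : ℝ} (hc : c = 1 ∨ c = -1) (X : DV) :
    gm (Arc c (2 * Real.pi * n)) X = gm X (Arc c (2 * Real.pi * n)) := by
  rw [Arc_loop n c hc]
  have h1 : Real.cos (c * (2 * Real.pi * n)) = 1 := by
    rcases hc with rfl | rfl
    · exact (Real.cos_eq_one_iff _).2 ⟨n, by push_cast; ring⟩
    · exact (Real.cos_eq_one_iff _).2 ⟨-n, by push_cast; ring⟩
  have h2 : Real.sin (c * (2 * Real.pi * n)) = 0 := by
    have := Real.sin_sq_add_cos_sq (c * (2 * Real.pi * n))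
    rw [h1] at this; nlinarith
  simp only [gm, h1, h2, Prod.mk.injEq]
  refine ⟨by ring, by ring, by ring⟩

lemma mid_arcs (p q : ℕ) {s : ℝ} (hs : s = 1 ∨ s = -1) (l : ℝ) :
    ((l, 0, s * (2 * Real.pi * ((p:ℝ) - q))) : DV) =
      gm (gm (Arc s (2 * Real.pi * p)) (Arc 0 l)) (Arc (-s) (2 * Real.pi * q)) := by
  rw [loop_comm p hs, gm_assoc, Arc_loop p s hs, Arc_loop q (-s) (by rcases hs with rfl | rfl <;> simp), Arc_zero]
  simp only [gm, Real.cos_zero, Real.sin_zero, Prod.mk.injEq]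
  refine ⟨by ring, by ring, by ring⟩

lemma no_loop {T : ℝ} {f : DV} (hAll : ∀ δ, Adm δ → Ev T δ = f → ∃ ρ β φ, PM T δ ρ β φ)
    {s a b l : ℝ} (hs : s = 1 ∨ s = -1) {p q : ℕ} (ha : 0 < a) (hb : 0 ≤ b) (hl : 0 < l) (hq : q ≠ 0)
    (hT : T = a + (l + 2 * Real.pi * ((p:ℝ) + q)) + b)
    (hf : f = gm (gm (Arc s a) (gm (gm (Arc s (2 * Real.pi * p)) (Arc 0 l)) (Arc (-s) (2 * Real.pi * q))))
      (Arc s b)) : False := by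
  have hpi := Real.pi_pos
  obtain ⟨e, he0, he1, he2⟩ : ∃ e, 0 < e ∧ e < a ∧ e < 2 * Real.pi := by
    obtain ⟨e, h, h'⟩ := exists_between (lt_min ha (show 0 < 2 * Real.pi by positivity))
    exact ⟨e, h, h'.trans_le (min_le_left _ _), h'.trans_le (min_le_right _ _)⟩
  have hs1 : |s| ≤ 1 := by rcases hs with rfl | rfl <;> simp
  have hs1' : |-s| ≤ 1 := by rwa [abs_neg]
  have hns : -s = 1 ∨ -s = -1 := by rcases hs with rfl | rfl <;> simp
  have hne : s ≠ -s := by rcases hs with rfl | rfl <;> norm_num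
  have hs0 : s ≠ 0 := by rcases hs with rfl | rfl <;> norm_num
  have hq' : (0:ℝ) < q := by exact_mod_cast Nat.pos_of_ne_zero hq
  have hqp : 0 < 2 * Real.pi * q := by positivity
  have hp0 : 0 ≤ 2 * Real.pi * (p:ℝ) := by positivity
  obtain ⟨δ, hδ, d0, d1, d2, d3, dE⟩ := chain3 (adm_lin hs1) (a := a - e + 2 * Real.pi * p)
    (l₁ := 2 * Real.pi * q) (l₂ := e) (l₃ := l) (c₁ := -s) (c₂ := s) (c₃ := 0)
    (b := b) (by linarith) hqp.le he0.le hl.le hb hs1' hs1 (by simp) (reach_arc (c := s) (l := b) hs1)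
  have hE : Ev T δ = f := by
    rw [show a - e + 2 * Real.pi * p + 2 * Real.pi * q + e + l + b = T by rw [hT]; ring] at dE
    rw [dE, hf]
    congr 1
    change gm (gm (gm (Arc s (a - e + 2 * Real.pi * p)) _) _) _ = _
    rw [gm_assoc _ (Arc (-s) _), loop_comm q hns, gm_assoc, gm_assoc, loop_comm q hns (Arc 0 l),
      ← gm_assoc, ← gm_assoc, ← gm_assoc, ← gm_assoc, ← Arc_add, ← Arc_add]
    rw [show a - e + 2 * Real.pi * p + e = a + 2 * Real.pi * p by ring]
  obtain ⟨ρ, β, φ, hP⟩ := hAll δ hδ hE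
  set v1 := a - e + 2 * Real.pi * p with hv1
  have hv10 : 0 < v1 := by rw [hv1]; linarith
  have hvT : v1 + 2 * Real.pi * q + e + l ≤ T := by rw [hT, hv1]; linarith
  have z2 := hP.switch (by linarith) (by linarith) (by linarith) (by linarith) d1 d2 hne.symm
  have z3 := hP.switch (by linarith) (by linarith) (by linarith) (by linarith) d2 d3 hs0
  have c2 := hP.cos_eq hs (by linarith) d2 z2 z3
  have e2 := d2 _ ⟨by linarith, le_rfl⟩
  set v3 := v1 + 2 * Real.pi * q + e with hv3
  -- singular
  have hsin : Real.sin (δ v3 - β) = 0 := by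
    have hx : v3 + l / 2 ∈ Ioo v3 (v3 + l) := ⟨by linarith, by linarith⟩
    have hd := hP.der (v3 + l / 2)
    have ev : φ =ᶠ[nhds (v3 + l / 2)] fun _ => 0 := by
      filter_upwards [Ioo_mem_nhds hx.1 hx.2] with y hy
      exact hP.sing (by linarith) hvT d3 hy
    have := hd.unique ((hasDerivAt_const _ _).congr_of_eventuallyEq ev)
    have hρ : ρ ≠ 0 := fun e => hP.ne e _ z2
    have e3 := d3 (v3 + l / 2) ⟨hx.1.le, hx.2.le⟩
    rw [zero_mul, add_zero] at e3
    rw [e3] at this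
    exact (mul_eq_zero.1 this).resolve_left hρ
  have e4 : δ (v1 + 2 * Real.pi * q) - β = (δ v3 - β) - s * e := by rw [e2, hv3]; ring
  rw [e4, Real.cos_sub (δ v3 - β) (s * e), hsin] at c2
  have e5 : Real.cos (s * e) = Real.cos e := by rcases hs with rfl | rfl <;> simp
  rw [e5] at c2
  have hcc : Real.cos (δ v3 - β) ≠ 0 := by
    intro h0
    have := Real.sin_sq_add_cos_sq (δ v3 - β)
    rw [hsin, h0] at this; norm_num at this
  have e6 : Real.cos e = 1 := by
    apply mul_left_cancel₀ hcc; linarith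
  have := (Real.cos_eq_one_iff_of_lt_of_lt (by linarith) he2).1 e6
  linarith

lemma word_of {T : ℝ} {f : DV} (hAll : ∀ δ, Adm δ → Ev T δ = f → ∃ ρ β φ, PM T δ ρ β φ)
    {s s' a b l : ℝ} (hs : s = 1 ∨ s = -1) (hs' : s' = 1 ∨ s' = -1) {p q : ℕ} (ha : 0 ≤ a) (hb : 0 ≤ b)
    (hl : 0 ≤ l) (hT : T = a + (l + 2 * Real.pi * ((p:ℝ) + q)) + b)
    (hf : f = gm (gm (Arc s a) (l, 0, 2 * Real.pi * ((p:ℝ) - q))) (Arc s' b)) : f ∈ Wd T := by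
  have hpi := Real.pi_pos
  -- opposite signs
  have opp : ∀ s : ℝ, (s = 1 ∨ s = -1) →
      f = gm (gm (Arc s a) (l, 0, 2 * Real.pi * ((p:ℝ) - q))) (Arc (-s) b) → f ∈ Wd T := by
    intro s hs hf
    obtain ⟨p', q', h1, h2⟩ : ∃ p' q' : ℕ, (p:ℝ) + q = p' + q' ∧ (p:ℝ) - q = s * (p' - q') := by
      rcases hs with rfl | rfl
      · exact ⟨p, q, rfl, by ring⟩
      · exact ⟨q, p, by ring, by ring⟩
    refine ⟨s, 0, -s, a + 2 * Real.pi * p', l, b + 2 * Real.pi * q', by positivity, hl, by positivity,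
      by rw [hT, h1]; ring, hs, by rcases hs with rfl | rfl <;> simp, Or.inl rfl, ?_⟩
    rw [hf, h2, show 2 * Real.pi * (s * ((p':ℝ) - q')) = s * (2 * Real.pi * (p' - q')) by ring,
      mid_arcs p' q' hs, Arc_add, add_comm b, Arc_add]
    simp only [gm_assoc]
  by_cases hss : s' = -s
  · subst hss; exact opp s hs hf
  obtain rfl : s' = s := by
    rcases hs with rfl | rfl <;> rcases hs' with rfl | rfl <;> first | rfl | (exfalso; apply hss; norm_num)
  rcases ha.eq_or_lt with h0 | ha
  · subst h0
    apply opp (-s') (by rcases hs with rfl | rfl <;> simp)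
    rw [hf, Arc_zero_len, Arc_zero_len, neg_neg]
  obtain ⟨p', q', h1, h2⟩ : ∃ p' q' : ℕ, (p:ℝ) + q = p' + q' ∧ (p:ℝ) - q = s' * (p' - q') := by
    rcases hs with rfl | rfl
    · exact ⟨p, q, rfl, by ring⟩
    · exact ⟨q, p, by ring, by ring⟩
  rw [h2, show 2 * Real.pi * (s' * ((p':ℝ) - q')) = s' * (2 * Real.pi * (p' - q')) by ring,
      mid_arcs p' q' hs] at hf
  rw [h1] at hT
  by_cases hq : q' = 0
  · subst hq
    refine ⟨s', 0, s', a + 2 * Real.pi * p', l, b, by positivity, hl, hb,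
      by rw [hT]; push_cast; ring, hs, hs, Or.inl rfl, ?_⟩
    rw [hf]
    simp only [Nat.cast_zero, mul_zero, Arc_zero_len, gm_one, Arc_add, gm_assoc]
  rcases hl.eq_or_lt with h0 | hl
  · subst h0
    refine ⟨s', -s', s', a + 2 * Real.pi * p', 2 * Real.pi * q', b, by positivity, by positivity, hb,
      by rw [hT]; ring, hs, hs, Or.inr ⟨rfl, rfl⟩, ?_⟩
    rw [hf, Arc_zero_len]
    simp only [gm_one, Arc_add, gm_assoc]
  · exact (no_loop hAll hs ha hb hl hq hT hf).elim

lemma case_sing {T : ℝ} {f : DV}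
    (hAll : ∀ δ, Adm δ → Ev T δ = f → ∃ ρ β φ, PM T δ ρ β φ)
    {γ : ℝ → ℝ} (hf : Ev T γ = f) {ρ β : ℝ} {φ : ℝ → ℝ} (h : PM T γ ρ β φ)
    {x : ℝ} (hx : x ∈ Icc 0 T) (hx0 : φ x = 0) (hsin : ρ * Real.sin (γ x - β) = 0) : f ∈ Wd T := by
  have hγ := h.adm
  have hγc := hγ.cont
  have hφc := h.cont
  have hρ : ρ ≠ 0 := fun e => h.ne e x hx0
  have hs0 := (mul_eq_zero.1 hsin).resolve_left hρ
  have hm : Real.cos (γ x - β) ^ 2 = 1 := by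
    have := Real.sin_sq_add_cos_sq (γ x - β)
    rw [hs0] at this; linarith
  have hz : ∀ y ∈ Icc 0 T, φ y = 0 → Real.cos (γ y - β) = Real.cos (γ x - β) := by
    intro y hy hy0
    have e1 := h.ham x hx
    have e2 := h.ham y hy
    rw [hx0, abs_zero] at e1
    rw [hy0, abs_zero] at e2
    apply mul_left_cancel₀ hρ; linarith
  have hcl : IsCompact ({t | φ t = 0} ∩ Icc 0 T) :=
    isCompact_Icc.inter_left (isClosed_eq hφc continuous_const)
  obtain ⟨a, ⟨za, ha⟩, ha'⟩ := hcl.exists_isLeast ⟨x, hx0, hx⟩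
  obtain ⟨b, ⟨zb, hb⟩, hb'⟩ := hcl.exists_isGreatest ⟨x, hx0, hx⟩
  simp only [mem_ofPred_eq] at za zb
  have hab : a ≤ b := ha' ⟨zb, hb⟩
  have sl1 : ∃ s, (s = 1 ∨ s = -1) ∧ Slope γ 0 a s := by
    rcases ha.1.eq_or_lt with e | e
    · refine ⟨1, Or.inl rfl, fun t ht => ?_⟩
      rw [← e] at ht
      rw [le_antisymm ht.2 ht.1]; simp
    · have n0 : φ 0 ≠ 0 := fun h0 => by
        have := ha' ⟨h0, le_rfl, ha.1.trans ha.2⟩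
        linarith
      obtain ⟨σ, hσ, hp⟩ := PM.sgn n0
      refine ⟨σ, hσ, h.slope σ hσ 0 a le_rfl e.le ha.2 fun t ht => ?_⟩
      refine h.sign_ext hp (y := t) (fun w hw hw0 => ?_) right_mem_uIcc
      rw [uIcc_of_le ht.1.le] at hw
      have := ha' ⟨hw0, hw.1, hw.2.trans (ht.2.le.trans ha.2)⟩
      linarith [hw.2, ht.2]
  have sl2 : ∃ s, (s = 1 ∨ s = -1) ∧ Slope γ b T s := by
    rcases hb.2.eq_or_lt with e | e
    · refine ⟨1, Or.inl rfl, fun t ht => ?_⟩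
      rw [← e] at ht
      rw [le_antisymm ht.2 ht.1]; simp
    · have n0 : φ T ≠ 0 := fun h0 => by
        have := hb' ⟨h0, hb.1.trans hb.2, le_rfl⟩
        linarith
      obtain ⟨σ, hσ, hp⟩ := PM.sgn n0
      refine ⟨σ, hσ, h.slope σ hσ b T hb.1 e.le le_rfl fun t ht => ?_⟩
      refine h.sign_ext hp (y := t) (fun w hw hw0 => ?_) right_mem_uIcc
      rw [uIcc_of_ge ht.2.le] at hw
      have := hb' ⟨hw0, hb.1.trans (ht.1.le.trans hw.1), hw.2⟩
      linarith [hw.1, ht.1]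
  obtain ⟨s, hs, sl1⟩ := sl1
  obtain ⟨s', hs', sl2⟩ := sl2
  obtain ⟨n, hn⟩ := exists_nat_gt ((b - a) / (2 * Real.pi))
  rw [div_lt_iff₀ (by positivity)] at hn
  obtain ⟨p, q, l, hl, e1, e2⟩ := h.mid hm hz n a b ha.1 hab hb.2 za zb (by linarith)
  refine word_of hAll hs hs' ha.1 (sub_nonneg.2 hb.2) hl (p := p) (q := q) (by linarith) ?_
  have E1 := sl1.ev hγc ha.1
  rw [Ev_zero hγ, one_gm, sub_zero] at E1
  rw [← hf, sl2.ev hγc hb.2, e2, E1]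

lemma BT {T : ℝ} (hT : 0 < T) {f : DV} (hf : f ∈ Reach T) (hR : ¬ Robust T f) : f ∈ Wd T := by
  have hAll : ∀ δ, Adm δ → Ev T δ = f → ∃ ρ β φ, PM T δ ρ β φ := by
    intro δ hδ hE
    by_cases hD : DExt T δ
    · obtain ⟨ρ, β, φ, h1, h2, h3, h4⟩ := pmp hδ hD
      exact ⟨ρ, β, φ, hδ, h1, h2, h3, h4⟩
    · exact absurd (hE ▸ robust_of hT hδ hD) hR
  obtain ⟨γ, hγ, hE⟩ := hf
  obtain ⟨ρ, β, φ, h⟩ := hAll γ hγ hE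
  by_cases hz : ∀ x ∈ Icc 0 T, φ x = 0 → ρ * Real.sin (γ x - β) ≠ 0
  · exact case_reg hT hAll hE h hz
  · push Not at hz
    obtain ⟨x, hx, h0, h1⟩ := hz
    exact case_sing hAll hE h hx h0 h1


lemma adm_subseq (γ : ℕ → ℝ → ℝ) (h : ∀ n, Adm (γ n)) :
    ∃ δ, Adm δ ∧ ∃ φ : ℕ → ℕ, StrictMono φ ∧
      ∀ t, Filter.Tendsto (fun n => γ (φ n) t) Filter.atTop (nhds (δ t)) := by
  have hK : IsCompact (Set.pi univ fun r : ℚ => Icc (-|(r:ℝ)|) |(r:ℝ)|) :=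
    isCompact_univ_pi fun r => isCompact_Icc
  obtain ⟨y, -, φ, hφ, hy⟩ := hK.tendsto_subseq (x := fun n (r : ℚ) => γ n r) (by
    intro n r _
    exact abs_le.1 (by simpa [(h n).2] using (h n).abs r 0))
  have hr : ∀ r : ℚ, Filter.Tendsto (fun n => γ (φ n) r) Filter.atTop (nhds (y r)) := fun r =>
    (tendsto_pi_nhds.1 hy r)
  have hl : ∀ t : ℝ, ∃ z, Filter.Tendsto (fun n => γ (φ n) t) Filter.atTop (nhds z) := by
    intro t
    apply cauchySeq_tendsto_of_complete
    rw [Metric.cauchySeq_iff']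
    intro ε hε
    obtain ⟨r, hr1, hr2⟩ := exists_rat_btwn (show t < t + ε / 3 by linarith)
    obtain ⟨N, hN⟩ := Metric.cauchySeq_iff'.1 (hr r).cauchySeq (ε / 3) (by positivity)
    refine ⟨N, fun n hn => ?_⟩
    have h1 := hN n hn
    have h2 := (h (φ n)).1.dist_le_mul t r
    have h3 := (h (φ N)).1.dist_le_mul t r
    have h4 : dist t (r:ℝ) < ε / 3 := by rw [Real.dist_eq, abs_lt]; constructor <;> linarith
    simp only [NNReal.coe_one, one_mul] at h2 h3
    have := dist_triangle4 (γ (φ n) t) (γ (φ n) r) (γ (φ N) r) (γ (φ N) t)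
    rw [dist_comm (γ (φ N) r)] at this
    linarith
  choose δ hδ using hl
  refine ⟨δ, adm_of (fun s t => ?_) ?_, φ, hφ, hδ⟩
  · refine le_of_tendsto ((hδ s).sub (hδ t)).abs (Filter.Eventually.of_forall fun n => ?_)
    have := (h (φ n)).1.dist_le_mul s t
    simpa [Real.dist_eq] using this
  · refine tendsto_nhds_unique (hδ 0) ?_
    simp [(h _).2]

lemma int_lim {F : ℝ → ℝ} (hF : Continuous F) (hF1 : ∀ x, |F x| ≤ 1) {γ : ℕ → ℝ → ℝ} {δ : ℝ → ℝ}
    (hγ : ∀ n, Continuous (γ n))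
    (hl : ∀ t, Filter.Tendsto (fun n => γ n t) Filter.atTop (nhds (δ t))) {Tn : ℕ → ℝ} {T : ℝ}
    (hT : Filter.Tendsto Tn Filter.atTop (nhds T)) :
    Filter.Tendsto (fun n => ∫ t in (0:ℝ)..(Tn n), F (γ n t)) Filter.atTop
      (nhds (∫ t in (0:ℝ)..T, F (δ t))) := by
  have h1 : Filter.Tendsto (fun n => ∫ t in (0:ℝ)..T, F (γ n t)) Filter.atTop
      (nhds (∫ t in (0:ℝ)..T, F (δ t))) := by
    apply intervalIntegral.tendsto_integral_filter_of_dominated_convergence (fun _ => 1)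
    · exact Filter.Eventually.of_forall fun n => (hF.comp (hγ n)).aestronglyMeasurable
    · exact Filter.Eventually.of_forall fun n => Filter.Eventually.of_forall fun t _ => hF1 _
    · exact intervalIntegrable_const
    · exact Filter.Eventually.of_forall fun t _ => (hF.tendsto _).comp (hl t)
  have h2 : Filter.Tendsto (fun n => ∫ t in T..(Tn n), F (γ n t)) Filter.atTop (nhds 0) := by
    apply squeeze_zero_norm (a := fun n => |Tn n - T|)
    · intro n
      have := intervalIntegral.norm_integral_le_of_norm_le_const (a := T) (b := Tn n) (C := 1)
        (f := fun t => F (γ n t)) (fun t _ => hF1 _)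
      simpa using this
    · have := (hT.sub_const T).abs
      simpa using this
  have h3 := h1.add h2
  rw [add_zero] at h3
  refine h3.congr fun n => ?_
  exact intervalIntegral.integral_add_adjacent_intervals
    ((hF.comp (hγ n)).intervalIntegrable _ _) ((hF.comp (hγ n)).intervalIntegrable _ _)

lemma reach_closed : IsClosed {x : ℝ × DV | x.2 ∈ Reach x.1} := by
  apply IsSeqClosed.isClosed
  intro x p hx hp
  choose γ hγ hE using hx
  obtain ⟨δ, hδ, φ, hφ, hl⟩ := adm_subseq γ hγ
  refine ⟨δ, hδ, ?_⟩
  have hp' := hp.comp hφ.tendsto_atTop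
  have hT : Filter.Tendsto (fun n => (x (φ n)).1) Filter.atTop (nhds p.1) :=
    (continuous_fst.tendsto _).comp hp'
  have hf : Filter.Tendsto (fun n => (x (φ n)).2) Filter.atTop (nhds p.2) :=
    (continuous_snd.tendsto _).comp hp'
  refine tendsto_nhds_unique ?_ hf
  simp only [← hE]
  have hc := fun n => (hγ (φ n)).cont
  refine (int_lim Real.continuous_cos Real.abs_cos_le_one hc hl hT).prodMk_nhds
    ((int_lim Real.continuous_sin Real.abs_sin_le_one hc hl hT).prodMk_nhds ?_)
  have h2 : Filter.Tendsto (fun n => γ (φ n) (x (φ n)).1 - γ (φ n) p.1) Filter.atTop (nhds 0) := by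
    apply squeeze_zero_norm (a := fun n => |(x (φ n)).1 - p.1|)
    · intro n
      have := (hγ (φ n)).1.dist_le_mul (x (φ n)).1 p.1
      simpa [Real.dist_eq] using this
    · have := (hT.sub_const p.1).abs
      simpa using this
  have h3 := (hl p.1).add h2
  rw [add_zero] at h3
  refine h3.congr fun n => by ring

lemma reach_zero {f : DV} (h : f ∈ Reach 0) : f ∈ Wd 0 := by
  obtain ⟨γ, hγ, rfl⟩ := h
  refine ⟨1, 0, 1, 0, 0, 0, le_rfl, le_rfl, le_rfl, by ring, Or.inl rfl, Or.inl rfl, Or.inl rfl, ?_⟩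
  simp [Ev, Arc, gm, hγ.2]

lemma sweep {g : ℝ → DV} (hg : Continuous g) {T : ℝ} (hT : 0 ≤ T) (h0 : g 0 ∈ Reach T) :
    ∃ s ∈ Icc 0 T, g s ∈ Wd (T - s) := by
  set S : Set ℝ := Icc 0 T ∩ {s | g s ∈ Reach (T - s)} with hS
  have hc : Continuous fun s : ℝ => ((T - s, g s) : ℝ × DV) := by fun_prop
  have hcl : IsCompact S := isCompact_Icc.inter_right (reach_closed.preimage hc)
  have hne : S.Nonempty := ⟨0, ⟨le_rfl, hT⟩, by simpa using h0⟩
  obtain ⟨s, ⟨hs, hs'⟩, hmax⟩ := hcl.exists_isGreatest hne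
  refine ⟨s, hs, ?_⟩
  rcases eq_or_lt_of_le hs.2 with e | hlt
  · have hs2 : g s ∈ Reach (T - s) := hs'
    rw [e, sub_self] at hs2 ⊢
    exact reach_zero hs2
  · refine BT (by linarith) hs' fun hR => ?_
    have h1 : ∀ᶠ t in nhds s, g t ∈ Reach (T - t) := hc.continuousAt.eventually hR
    have h2 : ∀ᶠ t in nhdsWithin s (Ioi s), g t ∈ Reach (T - t) ∧ t ∈ Ioo s T :=
      (h1.filter_mono nhdsWithin_le_nhds).and (Ioo_mem_nhdsGT hlt)
    obtain ⟨t, ht, ht'⟩ := h2.exists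
    have := hmax ⟨⟨hs.1.trans ht'.1.le, ht'.2.le⟩, ht⟩
    exact absurd ht'.1 (not_lt.2 this)


lemma u_int {u : ℝ → ℝ} {T : ℝ} (hu : Measurable u) (hb : ∀ t ∈ Icc 0 T, u t ∈ Icc (-1 : ℝ) 1)
    {a b : ℝ} (ha : 0 ≤ a) (hab : a ≤ b) (hbT : b ≤ T) : IntervalIntegrable u volume a b := by
  rw [intervalIntegrable_iff_integrableOn_Ioc_of_le hab]
  refine Measure.integrableOn_of_bounded (M := 1) (by simp) hu.aestronglyMeasurable ?_
  refine (ae_restrict_iff' measurableSet_Ioc).2 (Filter.Eventually.of_forall fun t ht => ?_)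
  exact abs_le.2 (hb t ⟨ha.trans ht.1.le, ht.2.trans hbT⟩)

lemma rhs_int {g u : ℝ → ℝ} {T : ℝ} (hg : ContinuousOn g (Icc 0 T)) (hu : Measurable u)
    (hb : ∀ t ∈ Icc 0 T, u t ∈ Icc (-1 : ℝ) 1) {t : ℝ} (ht : t ∈ Icc 0 T) :
    ∫ s in (0:ℝ)..t, ((Real.cos (g s), Real.sin (g s), u s) : ℝ × ℝ × ℝ) =
      (∫ s in (0:ℝ)..t, Real.cos (g s), ∫ s in (0:ℝ)..t, Real.sin (g s), ∫ s in (0:ℝ)..t, u s) := by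
  have hg' : ContinuousOn g (uIcc 0 t) := by
    rw [uIcc_of_le ht.1]; exact hg.mono (Icc_subset_Icc le_rfl ht.2)
  have h1 : IntervalIntegrable (fun s => Real.cos (g s)) volume 0 t :=
    (Real.continuous_cos.comp_continuousOn hg').intervalIntegrable
  have h2 : IntervalIntegrable (fun s => Real.sin (g s)) volume 0 t :=
    (Real.continuous_sin.comp_continuousOn hg').intervalIntegrable
  have h3 := u_int hu hb le_rfl ht.1 ht.2
  have h : IntervalIntegrable (fun s => ((Real.cos (g s), Real.sin (g s), u s) : ℝ × ℝ × ℝ))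
      volume 0 t := ⟨h1.1.prodMk (h2.1.prodMk h3.1), h1.2.prodMk (h2.2.prodMk h3.2)⟩
  refine Prod.ext ?_ (Prod.ext ?_ ?_)
  · exact ((ContinuousLinearMap.fst ℝ ℝ (ℝ × ℝ)).intervalIntegral_comp_comm h).symm
  · exact (((ContinuousLinearMap.fst ℝ ℝ ℝ).comp
      (ContinuousLinearMap.snd ℝ ℝ (ℝ × ℝ))).intervalIntegral_comp_comm h).symm
  · exact (((ContinuousLinearMap.snd ℝ ℝ ℝ).comp
      (ContinuousLinearMap.snd ℝ ℝ (ℝ × ℝ))).intervalIntegral_comp_comm h).symm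

lemma traj_reach {T : ℝ} (hT : 0 ≤ T) {χ : ℝ → ℝ × ℝ × ℝ} {u : ℝ → ℝ}
    (h : IsDubinsTraj 0 T (0, 0, 0) χ u) : ∃ γ, Adm γ ∧ ∀ t ∈ Icc 0 T, χ t = Ev t γ := by
  obtain ⟨hu, hb, hc, he⟩ := h
  have hg : ContinuousOn (fun t => (χ t).2.2) (Icc 0 T) :=
    (continuous_snd.comp continuous_snd).comp_continuousOn hc
  have he' : ∀ t ∈ Icc 0 T, χ t = (∫ s in (0:ℝ)..t, Real.cos (χ s).2.2,
      ∫ s in (0:ℝ)..t, Real.sin (χ s).2.2, ∫ s in (0:ℝ)..t, u s) := by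
    intro t ht
    rw [he t ht, ← rhs_int hg hu hb ht]
    change 0 + _ = _
    rw [zero_add]
    rfl
  set P : ℝ → ℝ := fun t => max 0 (min T t) with hP
  have hPm : ∀ t, P t ∈ Icc 0 T := fun t => ⟨le_max_left _ _, max_le hT (min_le_left _ _)⟩
  have hPi : ∀ t ∈ Icc 0 T, P t = t := fun t ht => by
    simp only [hP]; rw [min_eq_right ht.2, max_eq_right ht.1]
  have hPl : ∀ s t, |P s - P t| ≤ |s - t| := fun s t =>
    by
    have h1 := abs_max_sub_max_le_max 0 (min T s) 0 (min T t)
    have h2 := abs_min_sub_min_le_max T s T t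
    simp only [sub_self, abs_zero, abs_nonneg, sup_of_le_right] at h1 h2
    exact h1.trans h2
  have key : ∀ a b, a ∈ Icc 0 T → b ∈ Icc 0 T → a ≤ b → |(χ a).2.2 - (χ b).2.2| ≤ |a - b| := by
    intro a b ha hb' hab
    rw [he' a ha, he' b hb', abs_sub_comm, abs_sub_comm a b]
    change |(∫ s in (0:ℝ)..b, u s) - ∫ s in (0:ℝ)..a, u s| ≤ _
    rw [intervalIntegral.integral_interval_sub_left (u_int hu hb le_rfl hb'.1 hb'.2)
      (u_int hu hb le_rfl ha.1 ha.2)]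
    have := intervalIntegral.norm_integral_le_of_norm_le_const (a := a) (b := b) (C := 1)
        (f := u) (fun t ht => by
          rw [uIoc_of_le hab] at ht
          exact abs_le.2 (hb t ⟨ha.1.trans ht.1.le, ht.2.trans hb'.2⟩))
    simpa using this
  refine ⟨fun t => (χ (P t)).2.2, adm_of (fun s t => ?_) ?_, fun t ht => ?_⟩
  · refine le_trans ?_ (hPl s t)
    rcases le_total (P s) (P t) with h | h
    · exact key _ _ (hPm s) (hPm t) h
    · rw [abs_sub_comm, abs_sub_comm (P s)]
      exact key _ _ (hPm t) (hPm s) h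
  · have h0 : (0:ℝ) ∈ Icc 0 T := ⟨le_rfl, hT⟩
    simp only [hPi 0 h0, he' 0 h0]
    simp
  · have : Ev t (fun t => (χ (P t)).2.2) = Ev t (fun t => (χ t).2.2) :=
      Ev_congr ht.1 fun s hs => by rw [hPi s ⟨hs.1, hs.2.trans ht.2⟩]
    rw [this]
    have h3 := congrArg (fun x => x.2.2) (he' t ht)
    simp only [Ev, h3]
    exact he' t ht

/-- step function primitives are trajectories -/
lemma prim_traj {u : ℝ → ℝ} (hu : Measurable u) (hb : ∀ t, u t ∈ Icc (-1 : ℝ) 1) (T : ℝ) :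
    ∃ γ : ℝ → ℝ, Continuous γ ∧ IsDubinsTraj 0 T (0, 0, 0) (fun t => Ev t γ) u ∧
      (γ 0 = 0) ∧ ∀ a b c : ℝ, (∀ t ∈ Ico a b, u t = c) → Slope γ a b c := by
  have hi : ∀ a b, IntervalIntegrable u volume a b := by
    intro a b
    have : ∀ a b, IntegrableOn u (Ioc a b) volume := fun a b => by
      refine Measure.integrableOn_of_bounded (M := 1) (by simp) hu.aestronglyMeasurable ?_
      exact Filter.Eventually.of_forall fun t => abs_le.2 (hb t)
    exact ⟨this _ _, this _ _⟩
  have hγ : Continuous fun t => ∫ s in (0:ℝ)..t, u s := intervalIntegral.continuous_primitive hi 0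
  refine ⟨fun t => ∫ s in (0:ℝ)..t, u s, hγ, ⟨hu, fun t _ => hb t, ?_, ?_⟩, by simp, ?_⟩
  · apply Continuous.continuousOn
    have h1 : Continuous fun t => ∫ s in (0:ℝ)..t, Real.cos (∫ r in (0:ℝ)..s, u r) :=
      intervalIntegral.continuous_primitive
        (fun a b => (Real.continuous_cos.comp hγ).intervalIntegrable a b) 0
    have h2 : Continuous fun t => ∫ s in (0:ℝ)..t, Real.sin (∫ r in (0:ℝ)..s, u r) :=
      intervalIntegral.continuous_primitive
        (fun a b => (Real.continuous_sin.comp hγ).intervalIntegrable a b) 0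
    exact h1.prodMk (h2.prodMk hγ)
  · intro t ht
    have := rhs_int (T := T) hγ.continuousOn hu (fun t _ => hb t) ht
    change _ = 0 + _
    rw [zero_add]
    exact this.symm
  · intro a b c h t ht
    change (∫ s in (0:ℝ)..t, u s) = (∫ s in (0:ℝ)..a, u s) + c * (t - a)
    rw [← intervalIntegral.integral_add_adjacent_intervals (hi 0 a) (hi a t)]
    congr 1
    have : ∫ s in a..t, u s = ∫ s in a..t, c := by
      rw [intervalIntegral.integral_of_le ht.1, intervalIntegral.integral_of_le ht.1,
        ← integral_Ico_eq_integral_Ioc, ← integral_Ico_eq_integral_Ioc]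
      exact setIntegral_congr_fun measurableSet_Ico fun s hs => h s ⟨hs.1, hs.2.trans_le ht.2⟩
    rw [this]; simp; ring

def IsW (c₁ c₂ c₃ : ℝ) : Prop := (c₁ = 1 ∨ c₁ = -1) ∧ (c₃ = 1 ∨ c₃ = -1) ∧
  (c₂ = 0 ∨ (c₂ = -c₁ ∧ c₃ = c₁))

lemma ctrl_of {u : ℝ → ℝ} {a b t₁ t₂ c₁ c₂ c₃ : ℝ} (h : IsW c₁ c₂ c₃) (h1 : a ≤ t₁) (h2 : t₁ ≤ t₂)
    (h3 : t₂ ≤ b) (u1 : ∀ t ∈ Ico a t₁, u t = c₁) (u2 : ∀ t ∈ Ico t₁ t₂, u t = c₂)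
    (u3 : ∀ t ∈ Ico t₂ b, u t = c₃) : IsCSCControl a b u ∨ IsCCCControl a b u := by
  obtain ⟨hc1, hc3, hc2⟩ := h
  have m1 : c₁ ∈ ({-1, 1} : Set ℝ) := by rcases hc1 with rfl | rfl <;> simp
  have m3 : c₃ ∈ ({-1, 1} : Set ℝ) := by rcases hc3 with rfl | rfl <;> simp
  rcases hc2 with rfl | ⟨rfl, rfl⟩
  · exact Or.inl ⟨t₁, t₂, h1, h2, h3, c₁, m1, c₃, m3, fun t ht => u1 t ⟨ht.1.le, ht.2⟩,
      fun t ht => u2 t ⟨ht.1.le, ht.2⟩, fun t ht => u3 t ⟨ht.1.le, ht.2⟩⟩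
  · exact Or.inr ⟨t₁, t₂, h1, h2, h3, c₃, m1, fun t ht => u1 t ⟨ht.1.le, ht.2⟩,
      fun t ht => u2 t ⟨ht.1.le, ht.2⟩, fun t ht => u3 t ⟨ht.1.le, ht.2⟩⟩

lemma IsW.bd {c₁ c₂ c₃ : ℝ} (h : IsW c₁ c₂ c₃) :
    c₁ ∈ Icc (-1:ℝ) 1 ∧ c₂ ∈ Icc (-1:ℝ) 1 ∧ c₃ ∈ Icc (-1:ℝ) 1 := by
  obtain ⟨hc1, hc3, hc2⟩ := h
  rcases hc1 with rfl | rfl <;> rcases hc3 with rfl | rfl <;> rcases hc2 with rfl | ⟨rfl, -⟩ <;>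
    norm_num

lemma build {c₁ c₂ c₃ d₁ d₂ d₃ l₁ l₂ l₃ m₁ m₂ m₃ : ℝ} (hc : IsW c₁ c₂ c₃) (hd : IsW d₁ d₂ d₃)
    (hl₁ : 0 ≤ l₁) (hl₂ : 0 ≤ l₂) (hl₃ : 0 ≤ l₃) (hm₁ : 0 ≤ m₁) (hm₂ : 0 ≤ m₂) (hm₃ : 0 ≤ m₃) {τ T : ℝ}
    (hτ : τ = l₁ + l₂ + l₃) (hT : T = τ + m₁ + m₂ + m₃) :
    ∃ χ u, IsDubinsTraj 0 T (0, 0, 0) χ u ∧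
        (IsCSCControl 0 τ u ∨ IsCCCControl 0 τ u) ∧
        (IsCSCControl τ T u ∨ IsCCCControl τ T u) ∧
        (∀ x ∈ Icc 0 l₃, χ (l₁ + l₂ + x) = gm (gm (Arc c₁ l₁) (Arc c₂ l₂)) (Arc c₃ x)) ∧
        (∀ x ∈ Icc 0 m₁, χ (τ + x) =
          gm (gm (gm (Arc c₁ l₁) (Arc c₂ l₂)) (Arc c₃ l₃)) (Arc d₁ x)) ∧
        χ T = gm (gm (gm (gm (gm (Arc c₁ l₁) (Arc c₂ l₂)) (Arc c₃ l₃)) (Arc d₁ m₁)) (Arc d₂ m₂))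
          (Arc d₃ m₃) := by
  set u : ℝ → ℝ := fun t => if t < l₁ then c₁ else if t < l₁ + l₂ then c₂ else if t < τ then c₃ else
    if t < τ + m₁ then d₁ else if t < τ + m₁ + m₂ then d₂ else d₃ with hu
  have hum : Measurable u := by
    have hi : ∀ x : ℝ, MeasurableSet {t : ℝ | t < x} := fun x => measurableSet_Iio
    exact Measurable.ite (hi _) measurable_const (Measurable.ite (hi _) measurable_const
      (Measurable.ite (hi _) measurable_const (Measurable.ite (hi _) measurable_const
        (Measurable.ite (hi _) measurable_const measurable_const))))
  have hub : ∀ t, u t ∈ Icc (-1:ℝ) 1 := by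
    intro t
    simp only [hu]
    obtain ⟨a1, a2, a3⟩ := hc.bd
    obtain ⟨b1, b2, b3⟩ := hd.bd
    split_ifs <;> assumption
  have u1 : ∀ t ∈ Ico 0 l₁, u t = c₁ := fun t ht => by simp only [hu]; rw [if_pos ht.2]
  have u2 : ∀ t ∈ Ico l₁ (l₁ + l₂), u t = c₂ := fun t ht => by
    simp only [hu]; rw [if_neg (by linarith [ht.1]), if_pos ht.2]
  have u3 : ∀ t ∈ Ico (l₁ + l₂) τ, u t = c₃ := fun t ht => by
    simp only [hu]
    rw [if_neg (by linarith [ht.1]), if_neg (by linarith [ht.1]), if_pos ht.2]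
  have u4 : ∀ t ∈ Ico τ (τ + m₁), u t = d₁ := fun t ht => by
    simp only [hu]
    rw [if_neg (by linarith [ht.1]), if_neg (by linarith [ht.1]), if_neg (by linarith [ht.1]),
      if_pos ht.2]
  have u5 : ∀ t ∈ Ico (τ + m₁) (τ + m₁ + m₂), u t = d₂ := fun t ht => by
    simp only [hu]
    rw [if_neg (by linarith [ht.1]), if_neg (by linarith [ht.1]), if_neg (by linarith [ht.1]),
      if_neg (by linarith [ht.1]), if_pos ht.2]
  have u6 : ∀ t ∈ Ico (τ + m₁ + m₂) T, u t = d₃ := fun t ht => by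
    simp only [hu]
    rw [if_neg (by linarith [ht.1]), if_neg (by linarith [ht.1]), if_neg (by linarith [ht.1]),
      if_neg (by linarith [ht.1]), if_neg (by linarith [ht.1])]
  obtain ⟨γ, hγ, htr, h0, hs⟩ := prim_traj hum hub T
  have s1 := (hs _ _ _ u1).ev hγ hl₁
  have s2 := (hs _ _ _ u2).ev hγ (by linarith)
  have s3 : ∀ x ∈ Icc 0 l₃, Ev (l₁ + l₂ + x) γ = gm (gm (Arc c₁ l₁) (Arc c₂ l₂)) (Arc c₃ x) := by
    intro x hx
    have := ((hs _ _ _ u3).sub le_rfl (b' := l₁ + l₂ + x) (by linarith [hx.1])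
      (by linarith [hx.2])).ev hγ (by linarith [hx.1])
    rw [this, s2, s1, show Ev 0 γ = 0 by simp [Ev, h0], one_gm]
    congr 2 <;> ring_nf
  have sτ := s3 l₃ ⟨hl₃, le_rfl⟩
  rw [← hτ] at sτ
  have s4 : ∀ x ∈ Icc 0 m₁, Ev (τ + x) γ =
          gm (gm (gm (Arc c₁ l₁) (Arc c₂ l₂)) (Arc c₃ l₃)) (Arc d₁ x) := by
    intro x hx
    have := ((hs _ _ _ u4).sub le_rfl (b' := τ + x) (by linarith [hx.1])
      (by linarith [hx.2])).ev hγ (by linarith [hx.1])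
    rw [this, sτ, show τ + x - τ = x by ring]
  have s5 := (hs _ _ _ u5).ev hγ (by linarith)
  have s6 := (hs _ _ _ u6).ev hγ (by linarith)
  refine ⟨_, u, htr, ctrl_of hc hl₁ (by linarith) (by linarith) u1 u2 u3,
    ctrl_of hd (by linarith) (by linarith) (by linarith) u4 u5 u6, s3, s4, ?_⟩
  change Ev T γ = _
  rw [s6, s5, s4 m₁ ⟨hm₁, le_rfl⟩, show τ + m₁ + m₂ - (τ + m₁) = m₂ by ring,
    show T - (τ + m₁ + m₂) = m₃ by rw [hT]; ring]

lemma gm_cont {X : Type*} [TopologicalSpace X] {f g : X → DV} (hf : Continuous f)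
    (hg : Continuous g) : Continuous fun x => gm (f x) (g x) := by
  unfold gm
  fun_prop

lemma gi_cont {X : Type*} [TopologicalSpace X] {f : X → DV} (hf : Continuous f) :
    Continuous fun x => gi (f x) := by
  unfold gi
  fun_prop

lemma arc_cont {c : ℝ} (hc : c = 1 ∨ c = -1) : Continuous fun l => Arc c l := by
  rcases hc with rfl | rfl
  · simp only [Arc_one]; fun_prop
  · simp only [Arc_neg_one]; fun_prop

lemma gi_zero : gi 0 = 0 := by simp [gi, Prod.ext_iff]

theorem main_pos (T : ℝ) (hT : 0 < T) (χf : ℝ × ℝ × ℝ) (q : ℝ × ℝ × ℝ)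
    (hq : q ∈ DubinsTube T χf) :
      ∃ τ ∈ Set.Icc 0 T, ∃ χ u, IsDubinsTraj 0 T (0, 0, 0) χ u ∧ χ T = χf ∧
        (IsCSCControl 0 τ u ∨ IsCCCControl 0 τ u) ∧
        (IsCSCControl τ T u ∨ IsCCCControl τ T u) ∧
        q ∈ χ '' Set.Icc 0 T := by
  obtain ⟨χ, u, htr, hχT, t, ht, hχt⟩ := hq
  obtain ⟨γ, hγ, hE⟩ := traj_reach hT.le htr
  set S : Set ℝ := Icc 0 T ∩ {a | q ∈ Reach a ∧ gm (gi q) χf ∈ Reach (T - a)} with hS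
  have hne : S.Nonempty := by
    refine ⟨t, ht, ⟨γ, hγ, by rw [← hE t ht, hχt]⟩, sh t γ, hγ.sh t, ?_⟩
    rw [← hχT, ← hχt, hE t ht, hE T ⟨hT.le, le_rfl⟩, Ev_split hγ.cont t T, gi_gm_cancel]
  have hc1 : Continuous fun a : ℝ => ((a, q) : ℝ × DV) := by fun_prop
  have hc2 : Continuous fun a : ℝ => ((T - a, gm (gi q) χf) : ℝ × DV) := by fun_prop
  have hcl : IsCompact S := isCompact_Icc.inter_right
    ((reach_closed.preimage hc1).inter (reach_closed.preimage hc2))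
  obtain ⟨a, ⟨ha, ha1, ha2⟩, hmin⟩ := hcl.exists_isLeast hne
  have hW : q ∈ Wd a ∨ gm (gi q) χf ∈ Wd (T - a) := by
    rcases eq_or_lt_of_le ha.1 with e | h0
    · left; rw [← e] at ha1 ⊢; exact reach_zero ha1
    rcases eq_or_lt_of_le ha.2 with e | h1
    · right; rw [e, sub_self] at ha2 ⊢; exact reach_zero ha2
    by_contra hcon
    push Not at hcon
    have r1 : Robust a q := by
      by_contra h; exact hcon.1 (BT h0 ha1 h)
    have r2 : Robust (T - a) (gm (gi q) χf) := by
      by_contra h; exact hcon.2 (BT (by linarith) ha2 h)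
    have e1 : ∀ᶠ b in nhds a, q ∈ Reach b := hc1.continuousAt.eventually r1
    have e2 : ∀ᶠ b in nhds a, gm (gi q) χf ∈ Reach (T - b) := hc2.continuousAt.eventually r2
    have e3 : ∀ᶠ b in nhdsWithin a (Iio a), (q ∈ Reach b ∧ gm (gi q) χf ∈ Reach (T - b)) ∧
        b ∈ Ioo 0 a := ((e1.and e2).filter_mono nhdsWithin_le_nhds).and (Ioo_mem_nhdsLT h0)
    obtain ⟨b, hb, hb'⟩ := e3.exists
    have := hmin ⟨⟨hb'.1.le, hb'.2.le.trans ha.2⟩, hb⟩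
    exact absurd hb'.2 (not_lt.2 this)
  rcases hW with hW | hW
  · obtain ⟨c₁, c₂, c₃, l₁, l₂, l₃, hl₁, hl₂, hl₃, hsum, hc₁, hc₃, hc₂, hqe⟩ := hW
    obtain ⟨s, hs, d₁, d₂, d₃, m₁, m₂, m₃, hm₁, hm₂, hm₃, hsum', hd₁, hd₃, hd₂, hfe⟩ :=
      sweep (g := fun s => gm (gi (Arc c₃ s)) (gm (gi q) χf))
        (gm_cont (gi_cont (arc_cont hc₃)) continuous_const) (T := T - a) (by linarith [ha.2])
        (by simpa [Arc_zero_len, gi_zero, one_gm] using ha2)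
    obtain ⟨χ', u', h1, h2, h3, h4, h5, h6⟩ := build (c₁ := c₁) (c₂ := c₂) (c₃ := c₃) (d₁ := d₁)
      (d₂ := d₂) (d₃ := d₃) (l₁ := l₁) (l₂ := l₂) (l₃ := l₃ + s) (τ := a + s) (T := T)
      ⟨hc₁, hc₃, hc₂⟩ ⟨hd₁, hd₃, hd₂⟩ hl₁ hl₂ (by linarith [hs.1]) hm₁ hm₂ hm₃ (by linarith)
      (by linarith)
    refine ⟨a + s, ⟨by linarith [ha.1, hs.1], by linarith [hs.2]⟩, χ', u', h1, ?_, h2, h3, a, ha, ?_⟩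
    · have hfe' : χf = gm q (gm (Arc c₃ s) (gm (gm (Arc d₁ m₁) (Arc d₂ m₂)) (Arc d₃ m₃))) := by
        rw [← hfe]
        simp only [gm_gi_cancel]
      rw [h6, hfe', hqe, Arc_add]
      simp only [gm_assoc]
    · have := h4 l₃ ⟨hl₃, by linarith [hs.1]⟩
      rw [hsum] at this
      rw [this, hqe]
  · obtain ⟨d₁, d₂, d₃, m₁, m₂, m₃, hm₁, hm₂, hm₃, hsum', hd₁, hd₃, hd₂, hfe⟩ := hW
    obtain ⟨s, hs, c₁, c₂, c₃, l₁, l₂, l₃, hl₁, hl₂, hl₃, hsum, hc₁, hc₃, hc₂, hqe⟩ :=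
      sweep (g := fun s => gm q (gi (Arc d₁ s)))
        (gm_cont continuous_const (gi_cont (arc_cont hd₁))) (T := a) ha.1
        (by simpa [Arc_zero_len, gi_zero, gm_one] using ha1)
    obtain ⟨χ', u', h1, h2, h3, h4, h5, h6⟩ := build (c₁ := c₁) (c₂ := c₂) (c₃ := c₃) (d₁ := d₁)
      (d₂ := d₂) (d₃ := d₃) (l₁ := l₁) (l₂ := l₂) (l₃ := l₃) (m₁ := s + m₁) (τ := a - s) (T := T)
      ⟨hc₁, hc₃, hc₂⟩ ⟨hd₁, hd₃, hd₂⟩ hl₁ hl₂ hl₃ (by linarith [hs.1]) hm₂ hm₃ (by linarith)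
      (by linarith)
    have hqe' : q = gm (gm (gm (Arc c₁ l₁) (Arc c₂ l₂)) (Arc c₃ l₃)) (Arc d₁ s) := by
      rw [← hqe, gm_assoc, gi_gm, gm_one]
    refine ⟨a - s, ⟨by linarith [hs.2], by linarith [hs.1, ha.2]⟩, χ', u', h1, ?_, h2, h3, a, ha, ?_⟩
    · have hfe' : χf = gm q (gm (gm (Arc d₁ m₁) (Arc d₂ m₂)) (Arc d₃ m₃)) := by
        rw [← hfe, gm_gi_cancel]
      rw [h6, hfe', hqe', Arc_add]
      simp only [gm_assoc]
    · have := h5 s ⟨hs.1, by linarith⟩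
      rw [show a - s + s = a by ring] at this
      rw [this, ← hqe']

/-- **Theorem 3.** A point `q` belongs to the Dubins en route reachable
tube if and only if it is passed through by a Dubins trajectory from `χ_{2D,i}` to
`χ_{2D,f}` of length `T` which is of class CSC or CCC on `[0,τ]` and of class CSC or
CCC on `[τ,T]`, for some `τ ∈ [0,T]`. -/
theorem dubins_tube_iff_concatenation
    (T : ℝ) (hT : 0 < T) (χf : ℝ × ℝ × ℝ) (q : ℝ × ℝ × ℝ) :
    q ∈ DubinsTube T χf ↔
      ∃ τ ∈ Set.Icc 0 T, ∃ χ u, IsDubinsTraj 0 T (0, 0, 0) χ u ∧ χ T = χf ∧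
        (IsCSCControl 0 τ u ∨ IsCCCControl 0 τ u) ∧
        (IsCSCControl τ T u ∨ IsCCCControl τ T u) ∧
        q ∈ χ '' Set.Icc 0 T := by
  constructor
  · exact main_pos T hT χf q
  · rintro ⟨τ, -, χ, u, h, hf, -, -, t, ht, hq⟩
    exact ⟨χ, u, h, hf, t, ht, hq⟩
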